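/- Let π ∈ ℤ[ρ] be a primary prime with p = π·π̄ and let χ̃_π be the associated Hecke character of weight one. If p ≡ 7 or 13 (mod 18), then L(1, χ̃_π) ≠ 0. -/

import Mathlib

open Complex BigOperators

noncomputable section

/-- `ρ = e^{2πi/3}`, a primitive cube root of unity. -/
def ρ3 : ℂ := Complex.exp (2 * Real.pi * Complex.I / 3)

/-- The ring of Eisenstein integers `ℤ[ρ]`, realized as a subring of `ℂ`. -/
def O3 : Subring ℂ := Subring.closure {ρ3}

/-- `√−3 = i·√3`. -/
def sqrtm3 : ℂ := Complex.I * (Real.sqrt 3 : ℝ)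

/-- The congruence `a ≡ b (mod c)` in `ℤ[ρ]`. -/
def ECong (a b c : ℂ) : Prop := ∃ d ∈ O3, a - b = c * d

/-- `a` and `b` are coprime in `ℤ[ρ]`. -/
def ECoprime (a b : ℂ) : Prop := ∃ u ∈ O3, ∃ v ∈ O3, u * a + v * b = 1

/-- The real period `ϖ₁ = ∫₀¹ (1−x³)^{−2/3} dx`. -/
def varpi1 : ℝ := ∫ x in (0:ℝ)..(1:ℝ), (1 - x ^ 3) ^ (-(2:ℝ)/3)

/-- The points of the period lattice `ϖ₁·ℤ[ρ]`. -/
def ω3 (m : ℤ × ℤ) : ℂ := (varpi1 : ℂ) * ((m.1 : ℂ) + (m.2 : ℂ) * ρ3)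

/-- The Weierstrass `℘`-function of the period lattice `ϖ₁·ℤ[ρ]`
(so that `℘′² = 4℘³ − 27`). -/
def wp3 (u : ℂ) : ℂ :=
  (u ^ 2)⁻¹ + ∑' m : ℤ × ℤ, if m = 0 then 0 else (((u - ω3 m) ^ 2)⁻¹ - ((ω3 m) ^ 2)⁻¹)

/-- The derivative `℘′` of the Weierstrass `℘`-function of `ϖ₁·ℤ[ρ]`. -/
def wp3' (u : ℂ) : ℂ := ∑' m : ℤ × ℤ, (-2) * ((u - ω3 m) ^ 3)⁻¹

/-- The Weierstrass `ζ`-function of the period lattice `ϖ₁·ℤ[ρ]`. -/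
def wzeta3 (u : ℂ) : ℂ :=
  u⁻¹ + ∑' m : ℤ × ℤ, if m = 0 then 0 else ((u - ω3 m)⁻¹ + (ω3 m)⁻¹ + u * ((ω3 m) ^ 2)⁻¹)

/-- The non-analytic doubly periodic function `Z(u) = ζ(ϖ₁u) − (2π/(√3·ϖ₁))·ū`. -/
def Z3 (u : ℂ) : ℂ :=
  wzeta3 ((varpi1 : ℂ) * u) -
    ((2 * Real.pi / (Real.sqrt 3 * varpi1) : ℝ) : ℂ) * (starRingEnd ℂ) u

/-- The elliptic function `φ(u) = 6℘(ϖ₁u)/(9+℘′(ϖ₁u))` of period lattice `ℤ[ρ]`. -/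
def phi3 (u : ℂ) : ℂ := 6 * wp3 ((varpi1 : ℂ) * u) / (9 + wp3' ((varpi1 : ℂ) * u))

/-- The elliptic function `ψ(u) = (9−℘′(ϖ₁u))/(9+℘′(ϖ₁u))` of period lattice `ℤ[ρ]`. -/
def psi3 (u : ℂ) : ℂ := (9 - wp3' ((varpi1 : ℂ) * u)) / (9 + wp3' ((varpi1 : ℂ) * u))

/-- A residue class character modulo `β` on `ℤ[ρ]`. -/
structure IsResChar3 (β : ℂ) (χ : ℂ → ℂ) : Prop where
  periodic : ∀ a ∈ O3, ∀ b ∈ O3, ECong a b β → χ a = χ b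
  map_mul : ∀ a ∈ O3, ∀ b ∈ O3, χ (a * b) = χ a * χ b
  map_one : χ 1 = 1
  vanish : ∀ a ∈ O3, ¬ ECoprime a β → χ a = 0

/-- The cubic residue character `χ_π = (·/π)₃` modulo a prime `π` with `p = π·π̄`:
`χ_π(ν)³ = 1` and `χ_π(ν) ≡ ν^{(p−1)/3} (mod π)`. -/
structure IsCubicChar (π : ℂ) (p : ℕ) (χ : ℂ → ℂ) : Prop where
  resChar : IsResChar3 π χ
  cube : ∀ ν ∈ O3, ECoprime ν π → χ ν ^ 3 = 1
  euler : ∀ ν ∈ O3, ECoprime ν π → ECong (χ ν) (ν ^ ((p - 1) / 3)) π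

/-- The elliptic Gauss sum `G_π(χ, f) = (1/3)·Σ_{ν ∈ (ℤ[ρ]/(π))^×} χ(ν)·f(ν/π)`,
computed via the integer representatives `1, …, p−1` of `(ℤ[ρ]/(π))^× ≅ (ℤ/p)^×`. -/
def EGS3 (p : ℕ) (χ f : ℂ → ℂ) (π : ℂ) : ℂ :=
  (1/3 : ℂ) * ∑ r ∈ Finset.Icc 1 (p - 1), χ (r : ℂ) * f ((r : ℂ) / π)

/-- `S` is a third set of `(ℤ[ρ]/(π))^×`, i.e. `(ℤ[ρ]/(π))^× = S ∪ ρS ∪ ρ̄S`. -/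
def IsThirdSet (π : ℂ) (S : Finset ℂ) : Prop :=
  (∀ ν ∈ S, ν ∈ O3 ∧ ECoprime ν π) ∧
  (∀ a ∈ O3, ECoprime a π →
    ∃ ν ∈ S, ∃ ε ∈ ({1, ρ3, ρ3 ^ 2} : Set ℂ), ECong a (ε * ν) π) ∧
  (∀ ν ∈ S, ∀ μ ∈ S, ∀ ε ∈ ({1, ρ3, ρ3 ^ 2} : Set ℂ), ∀ ε' ∈ ({1, ρ3, ρ3 ^ 2} : Set ℂ),
    ECong (ε * ν) (ε' * μ) π → ν = μ ∧ ε = ε')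

/-- `γ(S)` is the cube root of unity with `γ(S) ≡ −∏_{ν∈S} ν (mod π)`. -/
def IsGamma3 (π : ℂ) (S : Finset ℂ) (γ : ℂ) : Prop :=
  γ ^ 3 = 1 ∧ ECong γ (-(∏ ν ∈ S, ν)) π

/-- `L` is the value at `s = 1` of the analytic continuation of the Hecke `L`-series
`L(s, χ̃) = Σ_𝔞 χ̃(𝔞)·N𝔞^{−s} = (1/6)·Σ_{ν ∈ ℤ[ρ]} χ₁(ν)·ν̄·|ν|^{−2s}` attached to the
weight-one Hecke character `χ̃((ν)) = χ₁(ν)·ν̄` of `ℚ(ρ)`. -/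
def IsLValue3 (χ₁ : ℂ → ℂ) (L : ℂ) : Prop :=
  ∃ F : ℂ → ℂ, DifferentiableOn ℂ F {s : ℂ | 0 < s.re} ∧
    (∀ s : ℂ, 3/2 < s.re →
      F s = (1/6 : ℂ) *
        ∑' ν : O3, χ₁ (ν : ℂ) * (starRingEnd ℂ) (ν : ℂ) *
          ((Complex.normSq (ν : ℂ) : ℂ) ^ (-s))) ∧
    F 1 = L

/-- `T` is a complete residue system modulo `β` in `ℤ[ρ]`. -/
def IsCRS3 (β : ℂ) (T : Finset ℂ) : Prop :=
  (∀ a ∈ T, a ∈ O3) ∧ (∀ a ∈ T, ∀ b ∈ T, ECong a b β → a = b) ∧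
  (∀ z ∈ O3, ∃ a ∈ T, ECong z a β)

/-- `e^{2πi·S(z)}` where `S(a + b·ρ̄) = a`, i.e. `2πi·S(z) = (2π/√3)·(zρ − z̄ρ̄)`. -/
def eS3 (z : ℂ) : ℂ :=
  Complex.exp (((2 * Real.pi / Real.sqrt 3 : ℝ) : ℂ) *
    (z * ρ3 - (starRingEnd ℂ) z * (starRingEnd ℂ) ρ3))

/-- `χ₀`: the character mod `3` giving the natural isomorphism `(ℤ[ρ]/(3))^× ≅ W`,
i.e. `χ₀(ν) = ε` for `ν ≡ ε (mod 3)`, `ε ∈ W = {±1, ±ρ, ±ρ̄}`. -/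
def IsChi0₃ (χ₀ : ℂ → ℂ) : Prop :=
  IsResChar3 3 χ₀ ∧ ∀ ε ∈ ({1, -1, ρ3, -ρ3, ρ3 ^ 2, -ρ3 ^ 2} : Set ℂ), χ₀ ε = ε

/-- `χ₀′`: the character mod `√−3` giving `(ℤ[ρ]/(√−3))^× ≅ {±1}`,
i.e. `χ₀′(ν) = δ` for `ν ≡ δ (mod √−3)`, `δ ∈ {±1}`. -/
def IsChi0'₃ (χ₀' : ℂ → ℂ) : Prop :=
  IsResChar3 sqrtm3 χ₀' ∧ χ₀' (-1) = -1

/-- The classical cubic (Kummer) Gauss sum `G₃(π) = Σ_{r=1}^{p−1} (r/π)₃·e^{2πir/p}`. -/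
def G3sum (p : ℕ) (χ : ℂ → ℂ) : ℂ :=
  ∑ r ∈ Finset.Icc 1 (p - 1), χ (r : ℂ) * Complex.exp (2 * Real.pi * Complex.I * (r : ℂ) / (p : ℂ))


theorem ρ3_eq : ρ3 = -1 / 2 + (Real.sqrt 3 / 2 : ℝ) * I := by
  have h : (2 * Real.pi * I / 3 : ℂ) = ((Real.pi - Real.pi / 3 : ℝ) : ℂ) * I := by
    push_cast; ring
  rw [ρ3, h, Complex.exp_mul_I, ← Complex.ofReal_cos, ← Complex.ofReal_sin, Real.cos_pi_sub,
    Real.sin_pi_sub, Real.cos_pi_div_three, Real.sin_pi_div_three]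
  push_cast; ring

theorem ρ3_re : ρ3.re = -1 / 2 := by
  rw [ρ3_eq]; norm_num

theorem ρ3_im : ρ3.im = Real.sqrt 3 / 2 := by
  rw [ρ3_eq]; norm_num

theorem ρ3_sq : ρ3 ^ 2 = -1 - ρ3 := by
  have h3 : Real.sqrt 3 ^ 2 = 3 := Real.sq_sqrt (by norm_num)
  apply Complex.ext
  · rw [pow_two, Complex.mul_re, Complex.sub_re, ρ3_re, ρ3_im]; norm_num; nlinarith
  · rw [pow_two, Complex.mul_im, Complex.sub_im, ρ3_re, ρ3_im]; norm_num; ring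

theorem ρ3_cube : ρ3 ^ 3 = 1 := by
  linear_combination (ρ3 - 1) * ρ3_sq

theorem conj_ρ3 : (starRingEnd ℂ) ρ3 = -1 - ρ3 := by
  apply Complex.ext
  · simp [ρ3_re]; norm_num
  · simp

theorem ρ3_ne_zero : ρ3 ≠ 0 := by
  intro h; have := ρ3_cube; rw [h] at this; norm_num at this

theorem sqrtm3_eq : sqrtm3 = 1 + 2 * ρ3 := by
  rw [sqrtm3, ρ3_eq]; push_cast; ring

theorem sqrtm3_sq : sqrtm3 ^ 2 = -3 := by
  rw [sqrtm3_eq]; linear_combination 4 * ρ3_sq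

theorem sqrtm3_ne_zero : sqrtm3 ≠ 0 := by
  intro h; have := sqrtm3_sq; rw [h] at this; norm_num at this

theorem ρ3_mem_O3 : ρ3 ∈ O3 := Subring.subset_closure rfl

theorem mem_O3_iff {z : ℂ} : z ∈ O3 ↔ ∃ a b : ℤ, z = a + b * ρ3 := by
  constructor
  · intro hz
    refine Subring.closure_induction (p := fun z _ => ∃ a b : ℤ, z = a + b * ρ3)
      ?_ ?_ ?_ ?_ ?_ ?_ hz
    · rintro x rfl; exact ⟨0, 1, by simp⟩
    · exact ⟨0, 0, by simp⟩
    · exact ⟨1, 0, by simp⟩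
    · rintro _ _ _ _ ⟨a, b, rfl⟩ ⟨c, d, rfl⟩; exact ⟨a + c, b + d, by push_cast; ring⟩
    · rintro _ _ ⟨a, b, rfl⟩; exact ⟨-a, -b, by push_cast; ring⟩
    · rintro _ _ _ _ ⟨a, b, rfl⟩ ⟨c, d, rfl⟩
      exact ⟨a * c - b * d, a * d + b * c - b * d, by
        push_cast; linear_combination (b * d : ℂ) * ρ3_sq⟩
  · rintro ⟨a, b, rfl⟩
    exact add_mem (intCast_mem O3 a) (mul_mem (intCast_mem O3 b) ρ3_mem_O3)

theorem conj_mem_O3 {z : ℂ} (hz : z ∈ O3) : (starRingEnd ℂ) z ∈ O3 := by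
  obtain ⟨a, b, rfl⟩ := mem_O3_iff.1 hz
  exact mem_O3_iff.2 ⟨a - b, -b, by simp [conj_ρ3]; ring⟩

theorem sqrtm3_mem_O3 : sqrtm3 ∈ O3 := mem_O3_iff.2 ⟨1, 2, by rw [sqrtm3_eq]; simp⟩

theorem int_add_mul_ρ3_mul_conj (a b : ℤ) :
    ((a : ℂ) + b * ρ3) * (starRingEnd ℂ) (a + b * ρ3) = ((a ^ 2 - a * b + b ^ 2 : ℤ) : ℂ) := by
  simp only [map_add, map_mul, map_intCast, conj_ρ3]
  push_cast; linear_combination (-b ^ 2 : ℂ) * ρ3_sq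

theorem exists_int_mul_conj {z : ℂ} (hz : z ∈ O3) : ∃ n : ℤ, z * (starRingEnd ℂ) z = n := by
  obtain ⟨a, b, rfl⟩ := mem_O3_iff.1 hz
  exact ⟨_, int_add_mul_ρ3_mul_conj a b⟩

/-- The primitive sixth root of unity `1 + ρ = -ρ²`. -/
def sixthRoot : ℂ := 1 + ρ3

theorem sixthRoot_sq : sixthRoot ^ 2 = sixthRoot - 1 := by
  rw [sixthRoot]; linear_combination ρ3_sq

theorem sixthRoot_sq_eq : sixthRoot ^ 2 = ρ3 := by
  rw [sixthRoot]; linear_combination ρ3_sq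

theorem sixthRoot_cube : sixthRoot ^ 3 = -1 := by
  linear_combination (sixthRoot + 1) * sixthRoot_sq

theorem sixthRoot_pow_six : sixthRoot ^ 6 = 1 := by
  linear_combination (sixthRoot ^ 3 - 1) * sixthRoot_cube

theorem sixthRoot_ne_zero : sixthRoot ≠ 0 := by
  intro h; have := sixthRoot_pow_six; rw [h] at this; norm_num at this

theorem sixthRoot_mem_O3 : sixthRoot ∈ O3 := add_mem (one_mem _) ρ3_mem_O3

theorem sixthRoot_mul_conj : sixthRoot * (starRingEnd ℂ) sixthRoot = 1 := by
  rw [sixthRoot, map_add, map_one, conj_ρ3]; linear_combination -ρ3_sq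

theorem conj_sixthRoot : (starRingEnd ℂ) sixthRoot = sixthRoot⁻¹ :=
  eq_inv_of_mul_eq_one_right sixthRoot_mul_conj

theorem norm_sixthRoot : ‖sixthRoot‖ = 1 := by
  have h : ‖sixthRoot‖ ^ 6 = 1 := by rw [← norm_pow, sixthRoot_pow_six, norm_one]
  exact (pow_eq_one_iff_of_nonneg (norm_nonneg _) (by norm_num)).1 h

theorem sixthRoot_zpow_eq_one_iff {k : ℤ} : sixthRoot ^ k = 1 ↔ (6 : ℤ) ∣ k := by
  have key : sixthRoot ^ k = sixthRoot ^ (k % 6).toNat := by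
    conv_lhs => rw [← Int.emod_add_mul_ediv k 6]
    rw [zpow_add₀ sixthRoot_ne_zero, zpow_mul]
    have : sixthRoot ^ (6 : ℤ) = 1 := by exact_mod_cast sixthRoot_pow_six
    rw [this, one_zpow, mul_one, ← zpow_natCast,
      Int.toNat_of_nonneg (Int.emod_nonneg _ (by norm_num))]
  have him : sixthRoot.im ≠ 0 := by
    simp [sixthRoot, ρ3_im]
  have hre : sixthRoot.re = 1 / 2 := by
    simp [sixthRoot, ρ3_re]; norm_num
  rw [key, Int.dvd_iff_emod_eq_zero]
  have h0 := Int.emod_nonneg k (show (6 : ℤ) ≠ 0 by norm_num)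
  have h6 := Int.emod_lt_of_pos k (show (0 : ℤ) < 6 by norm_num)
  generalize k % 6 = r at *
  have h4 : sixthRoot ^ 4 = -sixthRoot := by linear_combination sixthRoot * sixthRoot_cube
  have h5 : sixthRoot ^ 5 = 1 - sixthRoot := by
    linear_combination sixthRoot ^ 2 * sixthRoot_cube - sixthRoot_sq
  refine ⟨fun h => ?_, fun h => by simp [h]⟩
  interval_cases r
  · rfl
  · simp at h; rw [h] at him; simp at him
  · simp [sixthRoot_sq] at h; have := congrArg Complex.re h; simp [hre] at this; norm_num at this
  · simp [sixthRoot_cube] at h; norm_num at h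
  · simp [h4] at h; have := congrArg Complex.re h; simp [hre] at this; norm_num at this
  · simp [h5] at h; exact absurd h sixthRoot_ne_zero

/-- The pair of periods `1, ρ` of the lattice `ℤ[ρ]`. -/
def eisensteinPair : PeriodPair where
  ω₁ := 1
  ω₂ := ρ3
  indep := by
    rw [LinearIndependent.pair_iff]
    intro s t h
    have him := congrArg Complex.im h
    have hre := congrArg Complex.re h
    have h3 : Real.sqrt 3 ≠ 0 := by positivity
    simp [ρ3_im] at him
    simp [him] at hre
    exact ⟨hre, him⟩

theorem mem_lattice_iff {z : ℂ} : z ∈ eisensteinPair.lattice ↔ z ∈ O3 := by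
  rw [PeriodPair.mem_lattice, mem_O3_iff]
  simp [eisensteinPair, eq_comm]

open Filter Topology in
theorem eventually_ne_sixthRoot {p : ℂ → Prop} (h : ∀ᶠ u in 𝓝[≠] (0 : ℂ), p u) :
    ∀ᶠ u in 𝓝[≠] (0 : ℂ), p (sixthRoot * u) := by
  have ht : Tendsto (fun u : ℂ => sixthRoot * u) (𝓝[≠] 0) (𝓝[≠] 0) := by
    apply tendsto_nhdsWithin_of_tendsto_nhds_of_eventually_within
    · have : ContinuousAt (fun u : ℂ => sixthRoot * u) 0 := by fun_prop
      have h2 := this.tendsto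
      rw [mul_zero] at h2
      exact h2.mono_left nhdsWithin_le_nhds
    · filter_upwards [self_mem_nhdsWithin] with u hu
      exact mul_ne_zero sixthRoot_ne_zero hu
  exact ht.eventually h

open Filter Topology in
/-- A function with `f(ζu) = ζᵐ f(u)` near `0`, `ζ` a primitive sixth root of unity, has order
congruent to `m` modulo `6` at `0`. -/
theorem le_meromorphicOrderAt_of_sixthRoot {f : ℂ → ℂ} (hf : MeromorphicAt f 0) {m : ℤ}
    (hsym : ∀ u, f (sixthRoot * u) = sixthRoot ^ m * f u)
    (hlow : ((m - 5 : ℤ) : WithTop ℤ) ≤ meromorphicOrderAt f 0) :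
    (m : WithTop ℤ) ≤ meromorphicOrderAt f 0 := by
  cases ho : meromorphicOrderAt f 0 with
  | top => exact le_top
  | coe k =>
    obtain ⟨g, hg, hg0, hfg⟩ := (meromorphicOrderAt_eq_int_iff hf).1 ho
    simp only [sub_zero, smul_eq_mul] at hfg
    have h1 : ∀ᶠ u in 𝓝[≠] (0 : ℂ), sixthRoot ^ k * g (sixthRoot * u) = sixthRoot ^ m * g u := by
      filter_upwards [hfg, eventually_ne_sixthRoot hfg, self_mem_nhdsWithin] with u h1 h2 hu
      have hu0 : u ^ k ≠ 0 := zpow_ne_zero _ hu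
      have := hsym u
      rw [h1, h2, mul_zpow] at this
      apply mul_left_cancel₀ hu0
      linear_combination this
    have hc : ContinuousAt (fun u => sixthRoot ^ k * g (sixthRoot * u)) 0 := by
      have : ContinuousAt g (sixthRoot * 0) := by rw [mul_zero]; exact hg.continuousAt
      have h3 : ContinuousAt (fun u => g (sixthRoot * u)) 0 :=
        ContinuousAt.comp (f := fun u => sixthRoot * u) this (by fun_prop)
      fun_prop
    have hd : ContinuousAt (fun u => sixthRoot ^ m * g u) 0 := by
      have := hg.continuousAt; fun_prop
    have h2 := tendsto_nhds_unique
      ((hc.tendsto.mono_left nhdsWithin_le_nhds).congr' h1)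
      (hd.tendsto.mono_left nhdsWithin_le_nhds)
    rw [mul_zero] at h2
    have h3 : sixthRoot ^ k = sixthRoot ^ m := mul_right_cancel₀ hg0 h2
    have h4 : sixthRoot ^ (k - m) = 1 := by
      rw [zpow_sub₀ sixthRoot_ne_zero, h3, div_self (zpow_ne_zero _ sixthRoot_ne_zero)]
    obtain ⟨j, hj⟩ := sixthRoot_zpow_eq_one_iff.1 h4
    rw [ho] at hlow
    have h5 : m - 5 ≤ k := by exact_mod_cast hlow
    have h6 : m ≤ k := by omega
    exact_mod_cast h6

theorem exists_O3_add_norm_le (z : ℂ) : ∃ w ∈ O3, ‖z + w‖ ≤ 2 := by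
  have h3 : (0 : ℝ) < Real.sqrt 3 := by positivity
  obtain ⟨y, hy⟩ : ∃ y : ℝ, z.im = y * (Real.sqrt 3 / 2) :=
    ⟨z.im / (Real.sqrt 3 / 2), by field_simp⟩
  obtain ⟨x, hx⟩ : ∃ x : ℝ, x = z.re + y / 2 := ⟨_, rfl⟩
  have hz : z = x + y * ρ3 := by
    apply Complex.ext
    · simp [ρ3_re, hx]; ring
    · simp [ρ3_im, hy]
  refine ⟨-((⌊x⌋ : ℤ) + (⌊y⌋ : ℤ) * ρ3), neg_mem (mem_O3_iff.2 ⟨_, _, rfl⟩), ?_⟩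
  have hρ : ‖ρ3‖ = 1 := by
    rw [← sixthRoot_sq_eq, norm_pow, norm_sixthRoot, one_pow]
  have : z + -((⌊x⌋ : ℤ) + (⌊y⌋ : ℤ) * ρ3) = (Int.fract x : ℝ) + (Int.fract y : ℝ) * ρ3 := by
    simp only [Int.fract]; push_cast; rw [hz]; ring
  rw [this]
  refine (norm_add_le _ _).trans ?_
  rw [norm_mul, hρ, Complex.norm_real, Complex.norm_real, Real.norm_of_nonneg (Int.fract_nonneg _),
    Real.norm_of_nonneg (Int.fract_nonneg _)]
  linarith [(Int.fract_lt_one x).le, (Int.fract_lt_one y).le]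

open Filter Topology in
theorem ContinuousAt.eq_of_eventuallyEq_nhdsNE {f g : ℂ → ℂ} {z : ℂ} (hf : ContinuousAt f z)
    (hg : ContinuousAt g z) (h : f =ᶠ[𝓝[≠] z] g) : f z = g z :=
  tendsto_nhds_unique (hf.tendsto.mono_left nhdsWithin_le_nhds)
    ((hg.tendsto.mono_left nhdsWithin_le_nhds).congr' h.symm)

open Filter Topology in
/-- Liouville's theorem for elliptic functions with periods `ℤ[ρ]`. -/
theorem exists_eq_const_of_periodic {f : ℂ → ℂ} (hf : Meromorphic f)
    (hper : ∀ z, ∀ w ∈ O3, f (z + w) = f z) (hord : ∀ z, 0 ≤ meromorphicOrderAt f z) :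
    ∃ C, ∀ z, f =ᶠ[𝓝[≠] z] (fun _ => C) ∧ (ContinuousAt f z → f z = C) := by
  have hfo : MeromorphicOn f Set.univ := fun z _ => hf z
  set g := toMeromorphicNFOn f Set.univ
  have hfg : ∀ z, g =ᶠ[𝓝[≠] z] f := fun z =>
    (hfo.toMeromorphicNFOn_eq_self_on_nhdsNE (Set.mem_univ z))
  have hg : ∀ z, AnalyticAt ℂ g z := fun z => by
    have h1 := meromorphicNFOn_toMeromorphicNFOn f Set.univ (Set.mem_univ z)
    rw [← h1.meromorphicOrderAt_nonneg_iff_analyticAt,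
      meromorphicOrderAt_toMeromorphicNFOn hfo (Set.mem_univ z)]
    exact hord z
  have hgper : ∀ z, ∀ w ∈ O3, g (z + w) = g z := by
    intro z w hw
    have hc : ContinuousAt (fun u => g (u + w)) z :=
      ContinuousAt.comp (f := fun u => u + w) (hg _).continuousAt (by fun_prop)
    refine ContinuousAt.eq_of_eventuallyEq_nhdsNE hc (hg z).continuousAt ?_
    have ht : Tendsto (fun u : ℂ => u + w) (𝓝[≠] z) (𝓝[≠] (z + w)) := by
      apply tendsto_nhdsWithin_of_tendsto_nhds_of_eventually_within
      · have : ContinuousAt (fun u : ℂ => u + w) z := by fun_prop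
        exact this.tendsto.mono_left nhdsWithin_le_nhds
      · filter_upwards [self_mem_nhdsWithin] with u hu
        simpa using hu
    filter_upwards [hfg z, ht.eventually (hfg (z + w))] with u h1 h2
    rw [h1, h2, hper u w hw]
  have hgc : Continuous g := continuous_iff_continuousAt.2 fun z => (hg z).continuousAt
  have hbdd : Bornology.IsBounded (Set.range g) := by
    have hK : IsCompact (g '' Metric.closedBall 0 2) := (isCompact_closedBall 0 2).image hgc
    refine hK.isBounded.subset ?_
    rintro _ ⟨z, rfl⟩
    obtain ⟨w, hw, hn⟩ := exists_O3_add_norm_le z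
    exact ⟨z + w, by simpa using hn, hgper z w hw⟩
  have hgd : Differentiable ℂ g := fun z => (hg z).differentiableAt
  have hgz : ∀ z, g z = g 0 := fun z => hgd.apply_eq_apply_of_bounded hbdd z 0
  refine ⟨g 0, fun z => ⟨?_, fun hz => ?_⟩⟩
  · filter_upwards [hfg z] with u hu
    rw [← hu, hgz]
  · rw [← hgz z]
    exact (ContinuousAt.eq_of_eventuallyEq_nhdsNE (hg z).continuousAt hz (hfg z)).symm

theorem meromorphicOrderAt_add_of_periodic {f : ℂ → ℂ} (hper : ∀ z, ∀ w ∈ O3, f (z + w) = f z)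
    (z : ℂ) {w : ℂ} (hw : w ∈ O3) : meromorphicOrderAt f (z + w) = meromorphicOrderAt f z := by
  rw [← meromorphicOrderAt_comp_add_const_eq_meromorphicOrderAt]
  congr 1
  ext u
  exact hper u w hw

theorem meromorphicOrderAt_of_mem_O3 {f : ℂ → ℂ} (hper : ∀ z, ∀ w ∈ O3, f (z + w) = f z)
    {z : ℂ} (hz : z ∈ O3) : meromorphicOrderAt f z = meromorphicOrderAt f 0 := by
  simpa using meromorphicOrderAt_add_of_periodic hper 0 hz

/-- Elliptic functions of weight prime to `3` vanish at the points of order `√-3`. -/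
theorem eq_zero_of_sqrtm3_mul_mem {f : ℂ → ℂ} (hper : ∀ z, ∀ w ∈ O3, f (z + w) = f z) {m : ℤ}
    (hm : ¬ (3 : ℤ) ∣ m) (hsym : ∀ u, f (sixthRoot * u) = sixthRoot ^ m * f u) {z : ℂ}
    (hz : sqrtm3 * z ∈ O3) : f z = 0 := by
  have h1 : f (ρ3 * z) = f z := by
    have : ρ3 * z = z + (-ρ3 ^ 2 * (sqrtm3 * z)) := by
      rw [sqrtm3_eq]; linear_combination (2 * z * ρ3 - z) * ρ3_sq
    rw [this]
    exact hper _ _ (mul_mem (neg_mem (pow_mem ρ3_mem_O3 2)) hz)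
  have h2 : f (ρ3 * z) = sixthRoot ^ (2 * m) * f z := by
    rw [← sixthRoot_sq_eq, pow_two, mul_assoc, hsym, hsym, ← mul_assoc,
      ← zpow_add₀ sixthRoot_ne_zero, two_mul]
  have h3 : sixthRoot ^ (2 * m) ≠ 1 := by
    rw [Ne, sixthRoot_zpow_eq_one_iff]; omega
  have h4 : (sixthRoot ^ (2 * m) - 1) * f z = 0 := by
    linear_combination h1 - h2
  exact (mul_eq_zero.1 h4).resolve_left (sub_ne_zero.2 h3)

/-- Multiplication by the sixth root of unity as a permutation of the lattice. -/
def latticeRot : eisensteinPair.lattice ≃ eisensteinPair.lattice where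
  toFun x := ⟨sixthRoot * x, mem_lattice_iff.2 (mul_mem sixthRoot_mem_O3 (mem_lattice_iff.1 x.2))⟩
  invFun x := ⟨(starRingEnd ℂ) sixthRoot * x,
    mem_lattice_iff.2 (mul_mem (conj_mem_O3 sixthRoot_mem_O3) (mem_lattice_iff.1 x.2))⟩
  left_inv x := Subtype.ext <| by
    change (starRingEnd ℂ) sixthRoot * (sixthRoot * x) = x
    linear_combination (x : ℂ) * sixthRoot_mul_conj
  right_inv x := Subtype.ext <| by
    change sixthRoot * ((starRingEnd ℂ) sixthRoot * x) = x
    linear_combination (x : ℂ) * sixthRoot_mul_conj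

theorem coe_latticeRot (x : eisensteinPair.lattice) :
    ((latticeRot x : eisensteinPair.lattice) : ℂ) = sixthRoot * x := rfl

/-- The Weierstrass function of the lattice `ℤ[ρ]`. -/
abbrev wpE : ℂ → ℂ := eisensteinPair.weierstrassP

theorem wpE_periodic : ∀ z, ∀ w ∈ O3, wpE (z + w) = wpE z := fun z w hw =>
  eisensteinPair.weierstrassP_add_coe z ⟨w, mem_lattice_iff.2 hw⟩

theorem wpE_sixthRoot (u : ℂ) : wpE (sixthRoot * u) = sixthRoot ^ (4 : ℤ) * wpE u := by
  have h6 : sixthRoot ^ 4 = (sixthRoot ^ 2)⁻¹ := by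
    refine eq_inv_of_mul_eq_one_left ?_
    rw [← pow_add, sixthRoot_pow_six]
  simp only [wpE, PeriodPair.weierstrassP]
  rw [← tsum_mul_left, ← latticeRot.tsum_eq]
  refine tsum_congr fun x => ?_
  rw [coe_latticeRot, ← mul_sub, mul_pow, mul_pow, show (4 : ℤ) = ((4 : ℕ) : ℤ) by rfl,
    zpow_natCast, h6, one_div, one_div, one_div, one_div, mul_inv, mul_inv, mul_sub]

theorem wpE_meromorphic : Meromorphic wpE := eisensteinPair.meromorphic_weierstrassP

theorem order_wpE {z : ℂ} (hz : z ∈ O3) : meromorphicOrderAt wpE z = -2 :=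
  eisensteinPair.order_weierstrassP z (mem_lattice_iff.2 hz)

theorem analyticAt_wpE {z : ℂ} (hz : z ∉ O3) : AnalyticAt ℂ wpE z :=
  eisensteinPair.analyticOnNhd_weierstrassP z fun h => hz (mem_lattice_iff.1 h)

theorem order_wpE_ne_top (z : ℂ) : meromorphicOrderAt wpE z ≠ ⊤ := by
  have h : MeromorphicOn wpE Set.univ := fun z _ => wpE_meromorphic z
  refine h.meromorphicOrderAt_ne_top_of_isPreconnected (x := 0) isPreconnected_univ
    (Set.mem_univ _) (Set.mem_univ _) ?_
  rw [order_wpE (zero_mem _)]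
  decide

theorem one_le_order_of_eq_zero {f : ℂ → ℂ} {z : ℂ} (hf : AnalyticAt ℂ f z) (h0 : f z = 0) :
    1 ≤ meromorphicOrderAt f z := by
  rw [hf.meromorphicOrderAt_eq]
  have h1 : analyticOrderAt f z ≠ 0 := by
    rw [Ne, hf.analyticOrderAt_eq_zero]; simp [h0]
  cases h : analyticOrderAt f z with
  | top => simp
  | coe n =>
    rw [h] at h1
    have : 1 ≤ n := Nat.one_le_iff_ne_zero.2 (by exact_mod_cast h1)
    simp
    exact_mod_cast this

theorem one_le_order_wpE {z : ℂ} (hz : z ∉ O3) (hz' : sqrtm3 * z ∈ O3) :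
    1 ≤ meromorphicOrderAt wpE z :=
  one_le_order_of_eq_zero (analyticAt_wpE hz)
    (eq_zero_of_sqrtm3_mul_mem wpE_periodic (by norm_num) wpE_sixthRoot hz')

/-- The function `u ↦ ℘(√-3 u)`. -/
def wpEMul (u : ℂ) : ℂ := wpE (sqrtm3 * u)

theorem wpEMul_periodic : ∀ z, ∀ w ∈ O3, wpEMul (z + w) = wpEMul z := fun z w hw => by
  rw [wpEMul, mul_add, wpE_periodic _ _ (mul_mem sqrtm3_mem_O3 hw), wpEMul]

theorem wpEMul_sixthRoot (u : ℂ) : wpEMul (sixthRoot * u) = sixthRoot ^ (4 : ℤ) * wpEMul u := by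
  rw [wpEMul, mul_left_comm, wpE_sixthRoot, wpEMul]

theorem order_wpEMul (z : ℂ) :
    meromorphicOrderAt wpEMul z = meromorphicOrderAt wpE (sqrtm3 * z) := by
  have : wpEMul = wpE ∘ fun u => sqrtm3 * u := rfl
  rw [this, meromorphicOrderAt_comp_of_deriv_ne_zero (by fun_prop)]
  have : deriv (fun u => sqrtm3 * u) z = sqrtm3 := by
    simp
  rw [this]; exact sqrtm3_ne_zero

theorem wpEMul_meromorphic : Meromorphic wpEMul := fun z =>
  (wpE_meromorphic (sqrtm3 * z)).comp_analyticAt (f := wpE) (g := fun u => sqrtm3 * u)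
    (by fun_prop)

theorem analyticAt_wpEMul {z : ℂ} (hz : sqrtm3 * z ∉ O3) : AnalyticAt ℂ wpEMul z :=
  (analyticAt_wpE hz).fun_comp (g := wpE) (f := fun u => sqrtm3 * u) (by fun_prop)

theorem order_wpEMul_ne_top (z : ℂ) : meromorphicOrderAt wpEMul z ≠ ⊤ := by
  rw [order_wpEMul]; exact order_wpE_ne_top _

open Filter Topology in
/-- An elliptic function without poles that does not vanish identically is a nonzero constant. -/
theorem exists_ne_zero_eq_const_of_periodic {f : ℂ → ℂ} (hf : Meromorphic f)
    (hper : ∀ z, ∀ w ∈ O3, f (z + w) = f z) (hord : ∀ z, 0 ≤ meromorphicOrderAt f z)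
    {z₀ : ℂ} (hz₀ : meromorphicOrderAt f z₀ ≠ ⊤) :
    ∃ C, C ≠ 0 ∧ ∀ z, ContinuousAt f z → f z = C := by
  obtain ⟨C, hC⟩ := exists_eq_const_of_periodic hf hper hord
  refine ⟨C, ?_, fun z => (hC z).2⟩
  rintro rfl
  exact hz₀ (meromorphicOrderAt_eq_top_iff.2 (hC z₀).1)

theorem sqrtm3_mul_sqrtm3 (z : ℂ) : sqrtm3 * (sqrtm3 * z) = -(3 * z) := by
  linear_combination z * sqrtm3_sq

theorem sqrtm3_mul_sqrtm3_mem {z : ℂ} : sqrtm3 * (sqrtm3 * z) ∈ O3 ↔ 3 * z ∈ O3 := by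
  rw [sqrtm3_mul_sqrtm3, neg_mem_iff]

theorem notMem_of_sqrtm3_mul {z : ℂ} (h : sqrtm3 * z ∉ O3) : z ∉ O3 := fun hz =>
  h (mul_mem sqrtm3_mem_O3 hz)

theorem notMem_of_three_mul {z : ℂ} (h : 3 * z ∉ O3) : sqrtm3 * z ∉ O3 :=
  notMem_of_sqrtm3_mul fun h' => h (sqrtm3_mul_sqrtm3_mem.1 h')

/-- The function `u ↦ -3℘(√-3 u) - ℘(u)`. -/
def wpEBracket (u : ℂ) : ℂ := -3 * wpEMul u - wpE u

theorem wpEBracket_meromorphic : Meromorphic wpEBracket :=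
  fun z => ((MeromorphicAt.const (-3) z).mul (wpEMul_meromorphic z)).sub (wpE_meromorphic z)

theorem wpE_eq_except (u : ℂ) : wpE u = eisensteinPair.weierstrassPExcept 0 u + 1 / u ^ 2 := by
  have := eisensteinPair.weierstrassPExcept_def 0 u
  simp only [ZeroMemClass.coe_zero, sub_zero] at this
  rw [this]; simp

theorem four_le_order_wpEBracket {z : ℂ} (hz : z ∈ O3) : 4 ≤ meromorphicOrderAt wpEBracket z := by
  rw [meromorphicOrderAt_of_mem_O3 (fun z w hw => by
    rw [wpEBracket, wpE_periodic _ _ hw, wpEMul_periodic _ _ hw, wpEBracket]) hz]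
  refine le_meromorphicOrderAt_of_sixthRoot (m := 4) (wpEBracket_meromorphic 0) (fun u => ?_) ?_
  · rw [wpEBracket, wpE_sixthRoot, wpEMul_sixthRoot, wpEBracket]; ring
  · have h : wpEBracket = fun u => -3 * eisensteinPair.weierstrassPExcept 0 (sqrtm3 * u)
        - eisensteinPair.weierstrassPExcept 0 u := by
      ext u
      rw [wpEBracket, wpEMul, wpE_eq_except, wpE_eq_except, mul_pow, sqrtm3_sq]
      rcases eq_or_ne u 0 with rfl | hu
      · simp
      · field_simp; ring
    have ha := eisensteinPair.analyticAt_weierstrassPExcept 0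
    have ha' : AnalyticAt ℂ (fun u => eisensteinPair.weierstrassPExcept 0 (sqrtm3 * u)) 0 :=
      AnalyticAt.fun_comp (g := eisensteinPair.weierstrassPExcept 0) (f := fun u => sqrtm3 * u)
        (by rwa [mul_zero]) (by fun_prop)
    have hb : AnalyticAt ℂ wpEBracket 0 := by
      rw [h]; exact (analyticAt_const.mul ha').sub ha
    refine le_trans ?_ hb.meromorphicOrderAt_nonneg
    decide

theorem analyticAt_wpEBracket {z : ℂ} (hz : sqrtm3 * z ∉ O3) : AnalyticAt ℂ wpEBracket z :=
  (analyticAt_const.mul (analyticAt_wpEMul hz)).sub (analyticAt_wpE (notMem_of_sqrtm3_mul hz))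

theorem order_wpEBracket {z : ℂ} (hz : z ∉ O3) (hz' : sqrtm3 * z ∈ O3) :
    meromorphicOrderAt wpEBracket z = -2 := by
  have h1 : wpEBracket = (fun u => (-3 : ℂ) * wpEMul u) + (fun u => -wpE u) := by
    ext u; simp [wpEBracket]; ring
  have h2 : meromorphicOrderAt (fun u => (-3 : ℂ) * wpEMul u) z = -2 := by
    rw [← order_wpE hz', ← order_wpEMul,
      fun_meromorphicOrderAt_mul (MeromorphicAt.const (-3) z) (wpEMul_meromorphic z),
      meromorphicOrderAt_const]
    norm_num
  rw [h1, meromorphicOrderAt_add_eq_left_of_lt (wpE_meromorphic z).fun_neg, h2]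
  rw [h2, ← meromorphicOrderAt_fun_neg]
  exact lt_of_lt_of_le (by decide) (one_le_order_wpE hz hz')

/-- The multiplication formula for `√-3` on the curve `y² = 4x³ - g₃`. -/
theorem exists_wpE_sqrtm3_mul :
    ∃ b : ℂ, b ≠ 0 ∧ ∀ u, sqrtm3 * u ∉ O3 →
      (-3 * wpE (sqrtm3 * u) - wpE u) * wpE u ^ 2 = b := by
  have hP2 : ∀ z, meromorphicOrderAt (wpE ^ 2) z =
      meromorphicOrderAt wpE z + meromorphicOrderAt wpE z := fun z => by
    rw [pow_two, meromorphicOrderAt_mul (wpE_meromorphic z) (wpE_meromorphic z)]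
  have hmer : ∀ z, MeromorphicAt (wpE ^ 2) z := fun z => (wpE_meromorphic z).pow 2
  have hord : ∀ z, meromorphicOrderAt (wpEBracket * wpE ^ 2) z =
      meromorphicOrderAt wpEBracket z + (meromorphicOrderAt wpE z + meromorphicOrderAt wpE z) :=
      fun z => by
    rw [meromorphicOrderAt_mul (wpEBracket_meromorphic z) (hmer z), hP2]
  have han : ∀ z, sqrtm3 * z ∉ O3 → AnalyticAt ℂ (wpEBracket * wpE ^ 2) z := fun z hz =>
    (analyticAt_wpEBracket hz).mul ((analyticAt_wpE (notMem_of_sqrtm3_mul hz)).pow 2)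
  have hinv : sqrtm3 * sqrtm3⁻¹ = 1 := mul_inv_cancel₀ sqrtm3_ne_zero
  have hinv_mem : sqrtm3⁻¹ ∉ O3 := by
    intro h
    obtain ⟨n, hn⟩ := exists_int_mul_conj h
    have h3 : sqrtm3 * (starRingEnd ℂ) sqrtm3 = 3 := by
      rw [sqrtm3_eq]; simp only [map_add, map_mul, map_one, conj_ρ3]
      simp only [map_ofNat]; linear_combination -4 * ρ3_sq
    have h4 : (3 : ℂ) * n = 1 := by
      rw [← hn, ← h3, map_inv₀]
      have : (starRingEnd ℂ) sqrtm3 ≠ 0 := by simpa using sqrtm3_ne_zero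
      field_simp [sqrtm3_ne_zero]
    have h5 : (3 : ℤ) * n = 1 := by exact_mod_cast h4
    omega
  obtain ⟨b, hb, h⟩ := exists_ne_zero_eq_const_of_periodic (f := wpEBracket * wpE ^ 2)
    (z₀ := sqrtm3⁻¹) (fun z => (wpEBracket_meromorphic z).mul (hmer z))
    (fun z w hw => by
      simp only [Pi.mul_apply, Pi.pow_apply, wpEBracket]
      rw [wpE_periodic _ _ hw, wpEMul_periodic _ _ hw])
    (fun z => by
      by_cases hz : z ∈ O3
      · rw [hord, order_wpE hz]
        exact (by decide : (0 : WithTop ℤ) ≤ 4 + (-2 + -2)).trans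
          (add_le_add_left (four_le_order_wpEBracket hz) _)
      by_cases hz' : sqrtm3 * z ∈ O3
      · rw [hord, order_wpEBracket hz hz']
        exact (by decide : (0 : WithTop ℤ) ≤ -2 + (1 + 1)).trans
          (add_le_add_right (add_le_add (one_le_order_wpE hz hz') (one_le_order_wpE hz hz')) _)
      · exact (han z hz').meromorphicOrderAt_nonneg)
    (by
      rw [hord, order_wpEBracket hinv_mem (by rw [hinv]; exact one_mem _)]
      simp [order_wpE_ne_top])
  exact ⟨b, hb, fun u hu => h u (han u hu).continuousAt⟩

theorem wpE_ne_zero {u : ℂ} (hu : sqrtm3 * u ∉ O3) : wpE u ≠ 0 := by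
  obtain ⟨b, hb, h⟩ := exists_wpE_sqrtm3_mul
  intro h0
  have := h u hu
  rw [h0] at this
  exact hb (by rw [← this]; ring)

/-- Elliptic functions of weight `2` with at most simple poles, all at points of exact
order `√-3`, are multiples of `1 / ℘`. -/
theorem exists_mul_wpE_eq_const {K : ℂ → ℂ} (hK : Meromorphic K)
    (hper : ∀ z, ∀ w ∈ O3, K (z + w) = K z)
    (hsym : ∀ u, K (sixthRoot * u) = sixthRoot ^ (2 : ℤ) * K u)
    (hord : ∀ z, -1 ≤ meromorphicOrderAt K z)
    (han : ∀ z, ¬ (z ∉ O3 ∧ sqrtm3 * z ∈ O3) → AnalyticAt ℂ K z)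
    {z₀ : ℂ} (hz₀ : meromorphicOrderAt K z₀ ≠ ⊤) :
    ∃ C, C ≠ 0 ∧ ∀ u, sqrtm3 * u ∉ O3 → K u * wpE u = C := by
  have horder : ∀ z, meromorphicOrderAt (K * wpE) z =
      meromorphicOrderAt K z + meromorphicOrderAt wpE z := fun z =>
    meromorphicOrderAt_mul (hK z) (wpE_meromorphic z)
  have hana : ∀ z, sqrtm3 * z ∉ O3 → AnalyticAt ℂ (K * wpE) z := fun z hz =>
    (han z fun h => hz h.2).mul (analyticAt_wpE (notMem_of_sqrtm3_mul hz))
  obtain ⟨C, hC, h⟩ := exists_ne_zero_eq_const_of_periodic (f := K * wpE)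
    (z₀ := z₀) (fun z => (hK z).mul (wpE_meromorphic z))
    (fun z w hw => by
      simp only [Pi.mul_apply]
      rw [wpE_periodic _ _ hw, hper _ _ hw])
    (fun z => by
      by_cases hz : z ∈ O3
      · rw [horder, order_wpE hz, meromorphicOrderAt_of_mem_O3 hper hz]
        have h2 : 2 ≤ meromorphicOrderAt K 0 :=
          le_meromorphicOrderAt_of_sixthRoot (m := 2) (hK 0) hsym
            (le_trans (by decide) (hord 0))
        exact (by decide : (0 : WithTop ℤ) ≤ 2 + -2).trans (add_le_add_left h2 _)
      by_cases hz' : sqrtm3 * z ∈ O3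
      · rw [horder]
        exact (by decide : (0 : WithTop ℤ) ≤ -1 + 1).trans
          (add_le_add (hord z) (one_le_order_wpE hz hz'))
      · exact (hana z hz').meromorphicOrderAt_nonneg)
    (by rw [horder]; simp [order_wpE_ne_top, hz₀])
  exact ⟨C, hC, fun u hu => h u (hana u hu).continuousAt⟩

/-- Elliptic functions of weight `4` with at most simple poles, all at points of exact
order `3`, are multiples of `u ↦ 1 / (℘(u) ℘(√-3 u))`. -/
theorem exists_mul_wpE_mul_wpE_eq_const {K : ℂ → ℂ} (hK : Meromorphic K)
    (hper : ∀ z, ∀ w ∈ O3, K (z + w) = K z)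
    (hsym : ∀ u, K (sixthRoot * u) = sixthRoot ^ (4 : ℤ) * K u)
    (hord : ∀ z, -1 ≤ meromorphicOrderAt K z)
    (han : ∀ z, ¬ (sqrtm3 * z ∉ O3 ∧ 3 * z ∈ O3) → AnalyticAt ℂ K z)
    {z₀ : ℂ} (hz₀ : meromorphicOrderAt K z₀ ≠ ⊤) :
    ∃ C, C ≠ 0 ∧ ∀ u, 3 * u ∉ O3 → K u * wpE u * wpE (sqrtm3 * u) = C := by
  have horder : ∀ z, meromorphicOrderAt (K * wpE * wpEMul) z =
      meromorphicOrderAt K z + meromorphicOrderAt wpE z + meromorphicOrderAt wpEMul z := fun z => by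
    rw [meromorphicOrderAt_mul ((hK z).mul (wpE_meromorphic z)) (wpEMul_meromorphic z),
      meromorphicOrderAt_mul (hK z) (wpE_meromorphic z)]
  have hana : ∀ z, 3 * z ∉ O3 → AnalyticAt ℂ (K * wpE * wpEMul) z := fun z hz =>
    ((han z fun h => hz h.2).mul
      (analyticAt_wpE (notMem_of_sqrtm3_mul (notMem_of_three_mul hz)))).mul
      (analyticAt_wpEMul (notMem_of_three_mul hz))
  obtain ⟨C, hC, h⟩ := exists_ne_zero_eq_const_of_periodic (f := K * wpE * wpEMul)
    (z₀ := z₀) (fun z => ((hK z).mul (wpE_meromorphic z)).mul (wpEMul_meromorphic z))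
    (fun z w hw => by
      simp only [Pi.mul_apply]
      rw [wpE_periodic _ _ hw, hper _ _ hw, wpEMul_periodic _ _ hw])
    (fun z => by
      by_cases hz : z ∈ O3
      · rw [horder, order_wpE hz, meromorphicOrderAt_of_mem_O3 hper hz, order_wpEMul,
          order_wpE (mul_mem sqrtm3_mem_O3 hz)]
        have h4 : 4 ≤ meromorphicOrderAt K 0 :=
          le_meromorphicOrderAt_of_sixthRoot (m := 4) (hK 0) hsym
            (le_trans (by decide) (hord 0))
        exact (by decide : (0 : WithTop ℤ) ≤ 4 + -2 + -2).trans
          (add_le_add_left (add_le_add_left h4 _) _)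
      by_cases hz' : sqrtm3 * z ∈ O3
      · rw [horder, order_wpEMul, order_wpE hz']
        have h1 : 1 ≤ meromorphicOrderAt K z := one_le_order_of_eq_zero (han z fun h => h.1 hz')
          (eq_zero_of_sqrtm3_mul_mem hper (by norm_num) hsym hz')
        exact (by decide : (0 : WithTop ℤ) ≤ 1 + 1 + -2).trans
          (add_le_add_left (add_le_add h1 (one_le_order_wpE hz hz')) _)
      by_cases hz3 : 3 * z ∈ O3
      · rw [horder, order_wpEMul]
        exact (by decide : (0 : WithTop ℤ) ≤ -1 + 0 + 1).trans
          (add_le_add (add_le_add (hord z) (analyticAt_wpE hz).meromorphicOrderAt_nonneg)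
            (one_le_order_wpE hz' (sqrtm3_mul_sqrtm3_mem.2 hz3)))
      · exact (hana z hz3).meromorphicOrderAt_nonneg)
    (by rw [horder]; simp [order_wpE_ne_top, order_wpEMul_ne_top, hz₀])
  exact ⟨C, hC, fun u hu => h u (hana u hu).continuousAt⟩

/-- The weight-one kernel `z̄ |z|^{-2s}`. -/
def heckeG (s z : ℂ) : ℂ := (starRingEnd ℂ) z * (normSq z : ℂ) ^ (-s)

theorem heckeG_mul (s x y : ℂ) : heckeG s (x * y) = heckeG s x * heckeG s y := by
  rw [heckeG, heckeG, heckeG, map_mul, normSq_mul, ofReal_mul,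
    mul_cpow_ofReal_nonneg (normSq_nonneg _) (normSq_nonneg _)]
  ring

theorem heckeG_zero (s : ℂ) : heckeG s 0 = 0 := by simp [heckeG]

theorem heckeG_one (z : ℂ) : heckeG 1 z = z⁻¹ := by
  rw [heckeG, cpow_neg_one, ← ofReal_inv]
  exact (inv_def z).symm

theorem norm_heckeG {z : ℂ} (hz : z ≠ 0) (s : ℂ) : ‖heckeG s z‖ = ‖z‖ ^ (1 - 2 * s.re) := by
  have h0 : 0 < ‖z‖ := norm_pos_iff.2 hz
  rw [heckeG, norm_mul, RCLike.norm_conj, norm_cpow_eq_rpow_re_of_pos (normSq_pos.2 hz),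
    normSq_eq_norm_sq, neg_re, ← Real.rpow_natCast, ← Real.rpow_mul h0.le, sub_eq_add_neg,
    Real.rpow_add h0, Real.rpow_one]
  congr 2; push_cast; ring

theorem heckeG_ne_zero {z : ℂ} (hz : z ≠ 0) (s : ℂ) : heckeG s z ≠ 0 := by
  rw [← norm_pos_iff, norm_heckeG hz]
  exact Real.rpow_pos_of_pos (norm_pos_iff.2 hz) _

theorem heckeG_one_add {w : ℂ} (hw : 1 + w ≠ 0) (s : ℂ) :
    heckeG s (1 + w) = exp (-s * log (1 + w) + (1 - s) * (starRingEnd ℂ) (log (1 + w))) := by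
  have h1 : (normSq (1 + w) : ℂ) ≠ 0 := by
    rw [Ne, ofReal_eq_zero, normSq_eq_zero]; exact hw
  have h2 : log (normSq (1 + w) : ℂ) = log (1 + w) + (starRingEnd ℂ) (log (1 + w)) := by
    rw [add_conj, ← ofReal_log (normSq_nonneg _), normSq_eq_norm_sq, Real.log_pow, log_re]
    norm_num
  rw [heckeG, cpow_def_of_ne_zero h1, h2]
  nth_rewrite 1 [← exp_log hw]
  rw [← exp_conj, ← exp_add]
  congr 1; ring

/-- First order Taylor expansion of `heckeG s` at `1`. -/
theorem norm_heckeG_one_add_sub_le {M : ℝ} (hM : 1 ≤ M) {s w : ℂ} (hs : ‖s‖ ≤ M)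
    (hw : ‖w‖ * (6 * M) ≤ 1) :
    ‖heckeG s (1 + w) - (1 - s * w + (1 - s) * (starRingEnd ℂ) w)‖ ≤ 40 * M ^ 2 * ‖w‖ ^ 2 := by
  have hw0 := norm_nonneg w
  have hw2 : ‖w‖ ≤ 1 / 6 := by nlinarith
  have hne : 1 + w ≠ 0 := by
    intro h
    have : w = -1 := by linear_combination h
    rw [this] at hw2; norm_num at hw2
  rw [heckeG_one_add hne]
  set l := log (1 + w)
  have hl : ‖l - w‖ ≤ ‖w‖ ^ 2 := by
    refine (norm_log_one_add_sub_self_le (by linarith)).trans ?_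
    have : (1 - ‖w‖)⁻¹ ≤ 2 := by
      rw [inv_le_comm₀ (by linarith) (by norm_num)]; linarith
    nlinarith [sq_nonneg ‖w‖]
  have hl2 : ‖l‖ ≤ 2 * ‖w‖ := by
    calc ‖l‖ = ‖(l - w) + w‖ := by rw [sub_add_cancel]
      _ ≤ ‖l - w‖ + ‖w‖ := norm_add_le _ _
      _ ≤ 2 * ‖w‖ := by nlinarith
  have h1s : ‖1 - s‖ ≤ 1 + M := (norm_sub_le _ _).trans (by rw [norm_one]; linarith)
  have hlin : ∀ x : ℂ, ‖-s * x + (1 - s) * (starRingEnd ℂ) x‖ ≤ 3 * M * ‖x‖ := fun x => by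
    refine (norm_add_le _ _).trans ?_
    rw [norm_mul, norm_mul, norm_neg, RCLike.norm_conj]
    nlinarith [norm_nonneg x, mul_le_mul_of_nonneg_right hs (norm_nonneg x),
      mul_le_mul_of_nonneg_right h1s (norm_nonneg x)]
  set E := -s * l + (1 - s) * (starRingEnd ℂ) l
  have hE : ‖E‖ ≤ 6 * M * ‖w‖ := (hlin l).trans (by nlinarith)
  have hexp : ‖exp E - 1 - E‖ ≤ ‖E‖ ^ 2 := norm_exp_sub_one_sub_id_le (by linarith)
  have hd := hlin (l - w)
  have heq : exp E - (1 - s * w + (1 - s) * (starRingEnd ℂ) w) =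
      (exp E - 1 - E) + (-s * (l - w) + (1 - s) * (starRingEnd ℂ) (l - w)) := by
    simp only [E, map_sub]; ring
  rw [heq]
  refine (norm_add_le _ _).trans ?_
  have hE2 : ‖E‖ ^ 2 ≤ (6 * M * ‖w‖) ^ 2 := pow_le_pow_left₀ (norm_nonneg _) hE 2
  nlinarith [mul_le_mul_of_nonneg_left hl (by linarith : (0:ℝ) ≤ 3 * M),
    mul_nonneg (by nlinarith : (0:ℝ) ≤ M ^ 2 - M) (sq_nonneg ‖w‖)]

theorem norm_heckeG_add_sub_le {M : ℝ} (hM : 1 ≤ M) {s e x : ℂ} (hs : ‖s‖ ≤ M) (hx : x ≠ 0)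
    (he : ‖e‖ * (6 * M) ≤ ‖x‖) :
    ‖heckeG s (x + e) - heckeG s x * (1 - s * (e / x) + (1 - s) * (starRingEnd ℂ) (e / x))‖ ≤
      40 * M ^ 2 * ‖e‖ ^ 2 * ‖x‖ ^ (-1 - 2 * s.re) := by
  have hx0 : 0 < ‖x‖ := norm_pos_iff.2 hx
  have h1 : x + e = x * (1 + e / x) := by field_simp
  have h2 : ‖e / x‖ * (6 * M) ≤ 1 := by
    rw [norm_div, div_mul_eq_mul_div, div_le_one hx0]; exact he
  rw [h1, heckeG_mul, ← mul_sub, norm_mul, norm_heckeG hx]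
  refine (mul_le_mul_of_nonneg_left (norm_heckeG_one_add_sub_le hM hs h2) (by positivity)).trans ?_
  have h3 : ‖x‖ ^ (1 - 2 * s.re) = ‖x‖ ^ (-1 - 2 * s.re) * ‖x‖ ^ 2 := by
    rw [← Real.rpow_natCast, ← Real.rpow_add hx0]; congr 1; push_cast; ring
  rw [h3, norm_div]
  apply le_of_eq
  field_simp

theorem norm_sum_heckeG_le {J : Type*} [Fintype J] {w d : J → ℂ} (h0 : ∑ j, w j = 0)
    (h1 : ∑ j, w j * d j = 0) (h2 : ∑ j, w j * (starRingEnd ℂ) (d j) = 0) {M : ℝ} (hM : 1 ≤ M)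
    {B : ℝ} {s u x : ℂ} (hs : ‖s‖ ≤ M) (hx : x ≠ 0) (hB : ∀ j, ‖u + d j‖ ≤ B)
    (hxB : B * (6 * M) ≤ ‖x‖) :
    ‖∑ j, w j * heckeG s (u + d j + x)‖ ≤
      (∑ j, ‖w j‖) * (40 * M ^ 2 * B ^ 2) * ‖x‖ ^ (-1 - 2 * s.re) := by
  have hlin : ∑ j, w j * (heckeG s x * (1 - s * ((u + d j) / x) +
      (1 - s) * (starRingEnd ℂ) ((u + d j) / x))) = 0 := by
    have : ∀ j, w j * (heckeG s x * (1 - s * ((u + d j) / x) +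
        (1 - s) * (starRingEnd ℂ) ((u + d j) / x))) =
        w j * (heckeG s x * (1 - s * u / x + (1 - s) * (starRingEnd ℂ) (u / x))) +
        w j * d j * (heckeG s x * (-s / x)) +
        w j * (starRingEnd ℂ) (d j) * (heckeG s x * ((1 - s) / (starRingEnd ℂ) x)) := fun j => by
      simp only [map_div₀, map_add]; ring
    simp only [this, Finset.sum_add_distrib, ← Finset.sum_mul, h0, h1, h2, zero_mul, add_zero]
  rw [← sub_zero (∑ j, w j * heckeG s (u + d j + x)), ← hlin, ← Finset.sum_sub_distrib,
    mul_assoc, Finset.sum_mul]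
  refine norm_sum_le_of_le _ fun j _ => ?_
  rw [← mul_sub, norm_mul, add_comm (u + d j) x]
  refine mul_le_mul_of_nonneg_left ?_ (norm_nonneg _)
  refine (norm_heckeG_add_sub_le hM hs hx
    ((mul_le_mul_of_nonneg_right (hB j) (by linarith)).trans hxB)).trans ?_
  gcongr
  exact hB j

theorem summable_O3_rpow {r : ℝ} (hr : r < -2) : Summable fun μ : O3 => ‖(μ : ℂ)‖ ^ r := by
  have h := ZLattice.summable_norm_rpow eisensteinPair.lattice r (by simpa using hr)
  let e : O3 ≃ eisensteinPair.lattice := Equiv.subtypeEquivRight fun _ => mem_lattice_iff.symm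
  exact (e.summable_iff (f := fun z : eisensteinPair.lattice => ‖z‖ ^ r)).2 h

open Filter Topology in
theorem eventually_O3_le_norm (R : ℝ) : ∀ᶠ μ : O3 in cofinite, R ≤ ‖(μ : ℂ)‖ := by
  have h := (summable_O3_rpow (r := -3) (by norm_num)).tendsto_cofinite_zero
  have h1 : ∀ᶠ μ : O3 in cofinite, ‖(μ : ℂ)‖ ^ (-3 : ℝ) < (max R 1) ^ (-3 : ℝ) :=
    h.eventually_lt_const (Real.rpow_pos_of_pos (by positivity) _)
  filter_upwards [h1, (Set.finite_singleton (0 : O3)).compl_mem_cofinite] with μ hμ h0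
  have hpos : 0 < ‖(μ : ℂ)‖ := by
    rw [norm_pos_iff]; intro h; exact h0 (Subtype.ext h)
  by_contra! hlt
  exact absurd hμ (not_lt.2 (Real.rpow_le_rpow_of_nonpos hpos
    (hlt.le.trans (le_max_left _ _)) (by norm_num)))

section
variable {J : Type*} [Fintype J]

/-- Weighted sum of translates of the kernel. -/
def groupedTerm (w d : J → ℂ) (s u : ℂ) (μ : O3) : ℂ := ∑ j, w j * heckeG s (u + d j + μ)

/-- The lattice sum of the weighted translates of the kernel. -/
def groupedSum (w d : J → ℂ) (s u : ℂ) : ℂ := ∑' μ : O3, groupedTerm w d s u μ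

/-- The vanishing of the moments of order at most one of a weight system. -/
structure VanishingMoments (w d : J → ℂ) : Prop where
  sum_eq_zero : ∑ j, w j = 0
  sum_mul_eq_zero : ∑ j, w j * d j = 0
  sum_mul_conj_eq_zero : ∑ j, w j * (starRingEnd ℂ) (d j) = 0

variable {w d : J → ℂ}

theorem exists_norm_add_le (d : J → ℂ) (B : ℝ) : ∃ B', 0 ≤ B' ∧ ∀ u : ℂ, ‖u‖ ≤ B →
    ∀ j, ‖u + d j‖ ≤ B' := by
  refine ⟨max B 0 + ∑ j, ‖d j‖, by positivity, fun u hu j => (norm_add_le _ _).trans ?_⟩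
  exact add_le_add (hu.trans (le_max_left _ _))
    (Finset.single_le_sum (f := fun j => ‖d j‖) (fun _ _ => norm_nonneg _) (Finset.mem_univ j))

open Filter in
theorem VanishingMoments.exists_eventually_norm_le (h : VanishingMoments w d) (M B : ℝ) :
    ∃ C : ℝ, ∀ᶠ μ : O3 in cofinite, ∀ s u : ℂ, ‖s‖ ≤ M → 3 / 4 ≤ s.re → ‖u‖ ≤ B →
      ‖groupedTerm w d s u μ‖ ≤ C * ‖(μ : ℂ)‖ ^ (-5 / 2 : ℝ) := by
  obtain ⟨B', -, hB'⟩ := exists_norm_add_le d B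
  refine ⟨(∑ j, ‖w j‖) * (40 * (max M 1) ^ 2 * B' ^ 2), ?_⟩
  filter_upwards [eventually_O3_le_norm 1, eventually_O3_le_norm (B' * (6 * max M 1))]
    with μ h1 h2 s u hs hre hu
  have h0 : (μ : ℂ) ≠ 0 := by rw [← norm_pos_iff]; linarith
  refine (norm_sum_heckeG_le h.sum_eq_zero h.sum_mul_eq_zero h.sum_mul_conj_eq_zero
    (le_max_right M 1) (hs.trans (le_max_left _ _)) h0 (hB' u hu) h2).trans ?_
  refine mul_le_mul_of_nonneg_left ?_ (by positivity)
  exact Real.rpow_le_rpow_of_exponent_le h1 (by linarith)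

theorem VanishingMoments.summable (h : VanishingMoments w d) {s : ℂ} (hs : 3 / 4 ≤ s.re) (u : ℂ) :
    Summable (groupedTerm w d s u) := by
  obtain ⟨C, hC⟩ := h.exists_eventually_norm_le ‖s‖ ‖u‖
  refine Summable.of_norm_bounded_eventually
    ((summable_O3_rpow (r := -5 / 2) (by norm_num)).mul_left C) ?_
  filter_upwards [hC] with μ hμ using hμ s u le_rfl hs le_rfl

theorem differentiable_heckeG (z : ℂ) : Differentiable ℂ fun s => heckeG s z := by
  rcases eq_or_ne z 0 with rfl | hz
  · simp only [heckeG_zero]; fun_prop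
  · have : (normSq z : ℂ) ≠ 0 := by simpa using hz
    intro s
    exact (differentiableAt_const _).mul
      ((differentiableAt_id.neg).const_cpow (Or.inl this))

open Filter in
theorem VanishingMoments.differentiableOn (h : VanishingMoments w d) (u : ℂ) (M : ℝ) :
    DifferentiableOn ℂ (fun s => groupedSum w d s u) {s | 3 / 4 < s.re ∧ ‖s‖ < M} := by
  obtain ⟨C, hC⟩ := h.exists_eventually_norm_le M ‖u‖
  have hopen : IsOpen {s : ℂ | 3 / 4 < s.re ∧ ‖s‖ < M} :=
    (isOpen_lt continuous_const continuous_re).inter (isOpen_lt continuous_norm continuous_const)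
  have hu := tendstoUniformlyOn_tsum_of_cofinite_eventually (f := fun μ s => groupedTerm w d s u μ)
    ((summable_O3_rpow (r := -5 / 2) (by norm_num)).mul_left C)
    (s := {s : ℂ | 3 / 4 < s.re ∧ ‖s‖ < M}) (by
      filter_upwards [hC] with μ hμ s hs using hμ s u hs.2.le hs.1.le le_rfl)
  refine hu.tendstoLocallyUniformlyOn.differentiableOn (Eventually.of_forall fun t => ?_) hopen
  refine DifferentiableOn.fun_sum fun μ _ => DifferentiableOn.fun_sum fun j _ => ?_
  exact ((differentiable_heckeG _).const_mul _).differentiableOn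

/-- The Eisenstein–Kronecker type series `∑ wⱼ / (u + dⱼ + μ)`. -/
def latticeK (w d : J → ℂ) (u : ℂ) : ℂ := groupedSum w d 1 u

theorem latticeK_eq (u : ℂ) :
    latticeK w d u = ∑' μ : O3, ∑ j, w j * (u + d j + μ)⁻¹ := by
  simp only [latticeK, groupedSum, groupedTerm, heckeG_one]

theorem latticeK_periodic (z : ℂ) {v : ℂ} (hv : v ∈ O3) :
    latticeK w d (z + v) = latticeK w d z := by
  rw [latticeK_eq, latticeK_eq, ← (Equiv.addLeft (⟨v, hv⟩ : O3)).tsum_eq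
    fun μ : O3 => ∑ j, w j * (z + d j + μ)⁻¹]
  refine tsum_congr fun μ => Finset.sum_congr rfl fun j _ => ?_
  simp only [Equiv.coe_addLeft, Subring.coe_add]
  congr 2; ring

theorem latticeK_sixthRoot (σ : Equiv.Perm J) {θ : ℂ} (hw : ∀ j, w (σ j) = θ * w j)
    (hd : ∀ j, d (σ j) = sixthRoot * d j) (u : ℂ) :
    latticeK w d (sixthRoot * u) = θ * sixthRoot⁻¹ * latticeK w d u := by
  let e : O3 ≃ eisensteinPair.lattice := Equiv.subtypeEquivRight fun _ => mem_lattice_iff.symm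
  rw [latticeK_eq, latticeK_eq, ← tsum_mul_left,
    ← ((e.trans latticeRot).trans e.symm).tsum_eq]
  refine tsum_congr fun μ => ?_
  rw [Finset.mul_sum, ← Equiv.sum_comp σ]
  refine Finset.sum_congr rfl fun j _ => ?_
  have : (((e.trans latticeRot).trans e.symm) μ : ℂ) = sixthRoot * μ := rfl
  rw [this, hw, hd, ← mul_add, ← mul_add, mul_inv]
  ring

open Filter in
theorem VanishingMoments.exists_latticeK_eq_add (h : VanishingMoments w d) (B : ℝ) :
    ∃ (F : Finset O3) (g : ℂ → ℂ), DifferentiableOn ℂ g (Metric.ball 0 B) ∧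
      (∀ u ∈ Metric.ball (0 : ℂ) B,
        latticeK w d u = ∑ μ ∈ F, ∑ j, w j * (u + d j + μ)⁻¹ + g u) ∧
      ∀ μ, μ ∉ F → ∀ u ∈ Metric.ball (0 : ℂ) B, ∀ j, u + d j + μ ≠ 0 := by
  obtain ⟨C, hC⟩ := h.exists_eventually_norm_le 1 B
  obtain ⟨B', -, hB'⟩ := exists_norm_add_le d B
  have hfin := eventually_cofinite.1 (hC.and (eventually_O3_le_norm (B' + 1)))
  have hout : ∀ μ, μ ∉ (Set.Finite.toFinset hfin) →
      (∀ u ∈ Metric.ball (0 : ℂ) B, ‖groupedTerm w d 1 u μ‖ ≤ C * ‖(μ : ℂ)‖ ^ (-5 / 2 : ℝ)) ∧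
      ∀ u ∈ Metric.ball (0 : ℂ) B, ∀ j, u + d j + μ ≠ 0 := by
    intro μ hμ
    rw [Set.Finite.mem_toFinset] at hμ
    obtain ⟨h1, h2⟩ := not_not.1 hμ
    refine ⟨fun u hu => h1 1 u (by simp) (by norm_num) (mem_ball_zero_iff.1 hu).le,
      fun u hu j h0 => ?_⟩
    have h3 : (μ : ℂ) = -(u + d j) := by linear_combination h0
    rw [h3, norm_neg] at h2
    have := hB' u (mem_ball_zero_iff.1 hu).le j
    linarith
  refine ⟨_, fun u => ∑' μ : ((Set.Finite.toFinset hfin : Set O3)ᶜ : Set O3),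
    groupedTerm w d 1 u μ, ?_, fun u _ => ?_, fun μ hμ => (hout μ hμ).2⟩
  · refine Complex.differentiableOn_tsum_of_summable_norm
      (u := fun μ : ((Set.Finite.toFinset hfin : Set O3)ᶜ : Set O3) =>
        C * ‖((μ : O3) : ℂ)‖ ^ (-5 / 2 : ℝ))
      (((summable_O3_rpow (r := -5 / 2) (by norm_num)).mul_left C).subtype _)
      (fun μ => ?_) Metric.isOpen_ball fun μ u hu => (hout μ μ.2).1 u hu
    refine DifferentiableOn.fun_sum fun j _ => ?_
    simp only [heckeG_one]
    refine DifferentiableOn.const_mul (DifferentiableOn.fun_inv (by fun_prop) ?_) _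
    exact fun u hu => (hout μ μ.2).2 u hu j
  · rw [latticeK, groupedSum, ← (h.summable (s := 1) (by norm_num) u).sum_add_tsum_compl
      (s := Set.Finite.toFinset hfin)]
    simp only [groupedTerm, heckeG_one]

theorem neg_one_le_order_inv_add (c v z : ℂ) :
    -1 ≤ meromorphicOrderAt (fun u : ℂ => c * (u + v)⁻¹) z := by
  by_cases hz : z + v = 0
  · have h1 : meromorphicOrderAt (fun u : ℂ => (u + v)⁻¹) z = -1 := by
      have : (-1 : WithTop ℤ) = ((-1 : ℤ) : WithTop ℤ) := rfl
      rw [this, meromorphicOrderAt_eq_int_iff (by fun_prop)]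
      refine ⟨fun _ => 1, by fun_prop, one_ne_zero, Filter.Eventually.of_forall fun u => ?_⟩
      have : u - z = u + v := by linear_combination -hz
      rw [this]; simp
    rw [fun_meromorphicOrderAt_mul (by fun_prop) (by fun_prop), h1, meromorphicOrderAt_const]
    split_ifs
    · exact le_top
    · decide
  · have : AnalyticAt ℂ (fun u : ℂ => c * (u + v)⁻¹) z :=
      analyticAt_const.mul (AnalyticAt.inv (by fun_prop) hz)
    exact le_trans (by decide) this.meromorphicOrderAt_nonneg

theorem le_meromorphicOrderAt_sum {ι : Type*} (t : Finset ι) {f : ι → ℂ → ℂ} {z : ℂ}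
    {n : WithTop ℤ}
    (hf : ∀ i ∈ t, MeromorphicAt (f i) z) (h : ∀ i ∈ t, n ≤ meromorphicOrderAt (f i) z) :
    n ≤ meromorphicOrderAt (fun u => ∑ i ∈ t, f i u) z := by
  classical
  induction t using Finset.induction_on with
  | empty => simp [meromorphicOrderAt_const]
  | insert i t hi ih =>
    have h1 : (fun u => ∑ i ∈ insert i t, f i u) = f i + fun u => ∑ i ∈ t, f i u := by
      ext u; simp [Finset.sum_insert hi]
    rw [h1]
    refine le_trans (le_min (h i (Finset.mem_insert_self _ _)) (ih
      (fun k hk => hf k (Finset.mem_insert_of_mem hk))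
      (fun k hk => h k (Finset.mem_insert_of_mem hk)))) (meromorphicOrderAt_add
        (hf i (Finset.mem_insert_self _ _))
        (MeromorphicAt.fun_sum fun k hk => hf k (Finset.mem_insert_of_mem hk)))

end

section
variable {J : Type*} [Fintype J] {w d : J → ℂ}

open Filter Topology in
theorem VanishingMoments.exists_latticeK_eventuallyEq (h : VanishingMoments w d) (z : ℂ) :
    ∃ (F : Finset O3) (g : ℂ → ℂ), AnalyticAt ℂ g z ∧
      (latticeK w d =ᶠ[𝓝 z] fun u => ∑ μ ∈ F, ∑ j, w j * (u + d j + μ)⁻¹ + g u) ∧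
      ∀ μ, μ ∉ F → ∀ j, z + d j + μ ≠ 0 := by
  obtain ⟨F, g, hg, hK, hF⟩ := h.exists_latticeK_eq_add (‖z‖ + 1)
  have hz : z ∈ Metric.ball (0 : ℂ) (‖z‖ + 1) := by simp
  have hn := Metric.isOpen_ball.mem_nhds hz
  exact ⟨F, g, hg.analyticAt hn, by filter_upwards [hn] with u hu using hK u hu,
    fun μ hμ => hF μ hμ z hz⟩

theorem meromorphicAt_inv_add (c v₁ v₂ z : ℂ) :
    MeromorphicAt (fun u : ℂ => c * (u + v₁ + v₂)⁻¹) z := by fun_prop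

theorem meromorphicAt_sum_inv_add (F : Finset O3) (w d : J → ℂ) (z : ℂ) :
    MeromorphicAt (fun u => ∑ μ ∈ F, ∑ j, w j * (u + d j + (μ : ℂ))⁻¹) z :=
  MeromorphicAt.fun_sum fun _ _ => MeromorphicAt.fun_sum fun _ _ => meromorphicAt_inv_add _ _ _ _

theorem VanishingMoments.latticeK_meromorphic (h : VanishingMoments w d) :
    Meromorphic (latticeK w d) := fun z => by
  obtain ⟨F, g, hg, hK, -⟩ := h.exists_latticeK_eventuallyEq z
  exact ((meromorphicAt_sum_inv_add F w d z).fun_add hg.meromorphicAt).congr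
    (hK.symm.filter_mono nhdsWithin_le_nhds)

theorem VanishingMoments.neg_one_le_order_latticeK (h : VanishingMoments w d) (z : ℂ) :
    -1 ≤ meromorphicOrderAt (latticeK w d) z := by
  obtain ⟨F, g, hg, hK, -⟩ := h.exists_latticeK_eventuallyEq z
  rw [meromorphicOrderAt_congr (hK.filter_mono nhdsWithin_le_nhds)]
  refine le_trans (le_min ?_ ?_)
    (meromorphicOrderAt_add (meromorphicAt_sum_inv_add F w d z) hg.meromorphicAt)
  · refine le_meromorphicOrderAt_sum F (fun _ _ => MeromorphicAt.fun_sum fun _ _ =>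
      meromorphicAt_inv_add _ _ _ _) fun μ _ => le_meromorphicOrderAt_sum _
      (fun _ _ => meromorphicAt_inv_add _ _ _ _) fun j _ => ?_
    simpa only [add_assoc] using neg_one_le_order_inv_add (w j) (d j + μ) z
  · exact le_trans (by decide) hg.meromorphicOrderAt_nonneg

theorem VanishingMoments.analyticAt_latticeK (h : VanishingMoments w d) {z : ℂ}
    (hz : ∀ j, z + d j ∉ O3) : AnalyticAt ℂ (latticeK w d) z := by
  obtain ⟨F, g, hg, hK, -⟩ := h.exists_latticeK_eventuallyEq z
  refine AnalyticAt.congr ?_ hK.symm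
  refine AnalyticAt.fun_add (Finset.analyticAt_fun_sum _ fun μ _ =>
    Finset.analyticAt_fun_sum _ fun j _ => ?_) hg
  refine analyticAt_const.mul (AnalyticAt.fun_inv (by fun_prop) fun h0 => hz j ?_)
  have : z + d j = -(μ : ℂ) := by linear_combination h0
  rw [this]; exact neg_mem μ.2

open Filter Topology in
theorem tendsto_sub_mul_inv (c v z : ℂ) [Decidable (z + v = 0)] :
    Tendsto (fun u => (u - z) * (c * (u + v)⁻¹)) (𝓝[≠] z) (𝓝 (if z + v = 0 then c else 0)) := by
  split_ifs with h
  · refine tendsto_const_nhds.congr' ?_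
    filter_upwards [self_mem_nhdsWithin] with u hu
    have h1 : u + v = u - z := by linear_combination h
    rw [h1]
    field_simp [sub_ne_zero.2 hu]
  · have hc : ContinuousAt (fun u => (u - z) * (c * (u + v)⁻¹)) z := by
      have : ContinuousAt (fun u => (u + v)⁻¹) z := ContinuousAt.inv₀ (by fun_prop) h
      fun_prop
    simpa using hc.tendsto.mono_left nhdsWithin_le_nhds

open Filter Topology Classical in
/-- The residues of the series `∑ wⱼ / (u + dⱼ + μ)`. -/
theorem VanishingMoments.tendsto_sub_mul_latticeK (h : VanishingMoments w d) (z : ℂ) :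
    Tendsto (fun u => (u - z) * latticeK w d u) (𝓝[≠] z)
      (𝓝 (∑ j, if z + d j ∈ O3 then w j else 0)) := by
  obtain ⟨F, g, hg, hK, hF⟩ := h.exists_latticeK_eventuallyEq z
  have h1 : Tendsto (fun u => ∑ μ ∈ F, ∑ j, (u - z) * (w j * (u + (d j + μ))⁻¹) + (u - z) * g u)
      (𝓝[≠] z) (𝓝 (∑ μ ∈ F, ∑ j, (if z + (d j + (μ : ℂ)) = 0 then w j else 0) + 0)) := by
    refine Tendsto.add (tendsto_finsetSum _ fun μ _ => tendsto_finsetSum _ fun j _ =>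
      tendsto_sub_mul_inv _ _ _) ?_
    have hc : ContinuousAt (fun u => (u - z) * g u) z := by
      have := hg.continuousAt; fun_prop
    simpa using hc.tendsto.mono_left nhdsWithin_le_nhds
  have h2 : ∑ μ ∈ F, ∑ j, (if z + (d j + (μ : ℂ)) = 0 then w j else 0) + 0 =
      ∑ j, if z + d j ∈ O3 then w j else 0 := by
    rw [add_zero, Finset.sum_comm]
    refine Finset.sum_congr rfl fun j _ => ?_
    split_ifs with hj
    · set μ₀ : O3 := ⟨-(z + d j), neg_mem hj⟩
      have hμ : μ₀ ∈ F := by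
        by_contra hμ
        exact hF μ₀ hμ j (by simp [μ₀])
      rw [Finset.sum_eq_single_of_mem μ₀ hμ fun μ _ hne => ?_]
      · rw [if_pos]; simp [μ₀]
      · rw [if_neg]
        intro h0
        exact hne (Subtype.ext (by simp only [μ₀]; linear_combination h0))
    · refine Finset.sum_eq_zero fun μ _ => if_neg fun h0 => hj ?_
      have : z + d j = -(μ : ℂ) := by linear_combination h0
      rw [this]; exact neg_mem μ.2
  rw [← h2]
  refine h1.congr' ?_
  filter_upwards [hK.filter_mono nhdsWithin_le_nhds] with u hu
  rw [hu, mul_add, Finset.mul_sum]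
  simp only [Finset.mul_sum, add_assoc]

open Filter Topology Classical in
theorem VanishingMoments.order_latticeK_ne_top (h : VanishingMoments w d) {z : ℂ}
    (hz : ∑ j, (if z + d j ∈ O3 then w j else 0) ≠ 0) :
    meromorphicOrderAt (latticeK w d) z ≠ ⊤ := by
  intro ht
  refine hz (tendsto_nhds_unique (h.tendsto_sub_mul_latticeK z) ?_)
  refine tendsto_const_nhds.congr' ?_
  filter_upwards [meromorphicOrderAt_eq_top_iff.1 ht] with u hu
  rw [hu, mul_zero]

end

open Filter Topology in
/-- Uniqueness of the analytic continuation from `Re s > 3/2` to `s = 1`. -/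
theorem eq_at_one_of_eq_on_re_gt {F R : ℂ → ℂ} (hF : DifferentiableOn ℂ F {s : ℂ | 0 < s.re})
    (hR : DifferentiableOn ℂ R {s : ℂ | 3 / 4 < s.re ∧ ‖s‖ < 4})
    (h : ∀ s : ℂ, 3 / 2 < s.re → F s = R s) : F 1 = R 1 := by
  have hopen : IsOpen {s : ℂ | 3 / 4 < s.re ∧ ‖s‖ < 4} :=
    (isOpen_lt continuous_const continuous_re).inter (isOpen_lt continuous_norm continuous_const)
  have hconv : Convex ℝ {s : ℂ | 3 / 4 < s.re ∧ ‖s‖ < 4} := by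
    have h1 := (convex_halfSpace_re_gt (3 / 4)).inter (convex_ball (0 : ℂ) 4)
    convert h1 using 1
    ext s; simp
  have hF' : DifferentiableOn ℂ F {s : ℂ | 3 / 4 < s.re ∧ ‖s‖ < 4} :=
    hF.mono fun s hs => lt_trans (by norm_num) hs.1
  refine (hF'.analyticOnNhd hopen).eqOn_of_preconnected_of_eventuallyEq (hR.analyticOnNhd hopen)
    hconv.isPreconnected (z₀ := 2) (by norm_num) ?_ (by norm_num)
  filter_upwards [(isOpen_lt (continuous_const (y := (3 / 2 : ℝ))) continuous_re).mem_nhds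
    (show (2 : ℂ) ∈ {s : ℂ | 3 / 2 < s.re} by norm_num)] with s hs using h s hs

/-- `π` is an element of `ℤ[ρ]` whose norm is the rational prime `p`. -/
structure IsSplitPrime (p : ℕ) (π : ℂ) : Prop where
  prime : p.Prime
  mem : π ∈ O3
  norm_eq : (p : ℂ) = π * (starRingEnd ℂ) π

namespace IsSplitPrime
variable {p : ℕ} {π : ℂ}

theorem ne_zero (h : IsSplitPrime p π) : π ≠ 0 := by
  intro h0
  have := h.norm_eq
  rw [h0, zero_mul] at this
  exact h.prime.ne_zero (by exact_mod_cast this)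

theorem dvd_of_mul_conj_eq (h : IsSplitPrime p π) {z μ : ℂ} {n : ℤ} (hμ : μ ∈ O3)
    (hz : z = π * μ) (hn : z * (starRingEnd ℂ) z = n) : (p : ℤ) ∣ n := by
  obtain ⟨m, hm⟩ := exists_int_mul_conj hμ
  refine ⟨m, ?_⟩
  have : (n : ℂ) = (p : ℂ) * m := by
    rw [← hn, ← hm, h.norm_eq, hz, map_mul]; ring
  exact_mod_cast this

theorem dvd_of_intCast_eq (h : IsSplitPrime p π) {μ : ℂ} {n : ℤ} (hμ : μ ∈ O3)
    (hn : (n : ℂ) = π * μ) : (p : ℤ) ∣ n := by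
  have h2 : (p : ℤ) ∣ n ^ 2 := h.dvd_of_mul_conj_eq hμ hn (by push_cast; simp; ring)
  exact (Nat.prime_iff_prime_int.1 h.prime).dvd_of_dvd_pow h2

theorem exists_int_ρ3 (h : IsSplitPrime p π) : ∃ r : ℤ, ECong ρ3 r π := by
  obtain ⟨x, y, hxy⟩ := mem_O3_iff.1 h.mem
  have hp := Nat.prime_iff_prime_int.1 h.prime
  have hN : (p : ℤ) = x ^ 2 - x * y + y ^ 2 := by
    have := h.norm_eq
    rw [hxy, int_add_mul_ρ3_mul_conj] at this
    exact_mod_cast this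
  have hy : ¬ (p : ℤ) ∣ y := by
    intro hy
    have hx2 : (p : ℤ) ∣ x ^ 2 := by
      have : x ^ 2 = p + y * (x - y) := by rw [hN]; ring
      rw [this]; exact dvd_add dvd_rfl (hy.mul_right _)
    obtain ⟨x', rfl⟩ := hp.dvd_of_dvd_pow hx2
    obtain ⟨y', rfl⟩ := hy
    have h1 : (p : ℤ) * (p * (x' ^ 2 - x' * y' + y' ^ 2)) = p * 1 := by
      rw [mul_one]; nth_rewrite 3 [hN]; ring
    have h2 := mul_left_cancel₀ hp.ne_zero h1
    exact hp.not_isUnit (IsUnit.of_mul_eq_one _ h2)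
  obtain ⟨u, v, huv⟩ := (Int.isCoprime_iff_gcd_eq_one.2 (by
    rw [Int.gcd_comm]
    exact (Int.isCoprime_iff_gcd_eq_one.1 ((Prime.coprime_iff_not_dvd hp).2 hy).symm)) :
      IsCoprime (p : ℤ) y)
  refine ⟨-(v * x), v + (starRingEnd ℂ) π * (u * ρ3), add_mem (intCast_mem O3 v)
    (mul_mem (conj_mem_O3 h.mem) (mul_mem (intCast_mem O3 u) ρ3_mem_O3)), ?_⟩
  have h3 : (u : ℂ) * (p : ℂ) + v * y = 1 := by exact_mod_cast huv
  rw [mul_add, ← mul_assoc, ← h.norm_eq]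
  push_cast
  linear_combination -(v : ℂ) * hxy - ρ3 * h3

theorem exists_nat_sub_eq (h : IsSplitPrime p π) {ν : ℂ} (hν : ν ∈ O3) :
    ∃ a < p, ∃ μ ∈ O3, ν - a = π * μ := by
  obtain ⟨r, d, hd, hr⟩ := h.exists_int_ρ3
  obtain ⟨x, y, rfl⟩ := mem_O3_iff.1 hν
  have hp0 : (p : ℤ) ≠ 0 := by exact_mod_cast h.prime.ne_zero
  set n := x + y * r
  have h0 := Int.emod_nonneg n hp0
  refine ⟨(n % p).toNat, ?_, y * d + (starRingEnd ℂ) π * (n / p : ℤ),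
    add_mem (mul_mem (intCast_mem O3 y) hd) (mul_mem (conj_mem_O3 h.mem) (intCast_mem O3 _)), ?_⟩
  · have := Int.emod_lt_of_pos n (show (0 : ℤ) < p by exact_mod_cast h.prime.pos)
    omega
  · have h1 : (((n % p).toNat : ℕ) : ℂ) = ((n % p : ℤ) : ℂ) := by
      rw [← Int.cast_natCast, Int.toNat_of_nonneg h0]
    have h2 : ((n % p : ℤ) : ℂ) + p * ((n / p : ℤ) : ℂ) = x + y * r := by
      exact_mod_cast Int.emod_add_mul_ediv n p
    rw [h1]
    linear_combination y * hr - h2 + ((n / p : ℤ) : ℂ) * h.norm_eq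

theorem eq_of_sub_eq (h : IsSplitPrime p π) {a b : ℕ} (ha : a < p) (hb : b < p) {μ : ℂ}
    (hμ : μ ∈ O3) (hab : (a : ℂ) - b = π * μ) : a = b := by
  have : (p : ℤ) ∣ (a : ℤ) - b := h.dvd_of_intCast_eq hμ (by push_cast; exact hab)
  have h2 := Int.eq_zero_of_abs_lt_dvd this (by rw [abs_lt]; omega)
  omega

theorem not_coprime_zero (h : IsSplitPrime p π) : ¬ ECoprime 0 π := by
  rintro ⟨u, -, v, hv, huv⟩
  have : (p : ℤ) ∣ 1 := h.dvd_of_intCast_eq hv (by push_cast; linear_combination -huv)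
  exact h.prime.one_lt.ne' (by exact_mod_cast Int.eq_one_of_dvd_one (by positivity) this)

theorem coprime_natCast (h : IsSplitPrime p π) {a : ℕ} (ha : ¬ p ∣ a) : ECoprime a π := by
  have h1 : IsCoprime (p : ℤ) (a : ℤ) := by
    rw [Prime.coprime_iff_not_dvd (Nat.prime_iff_prime_int.1 h.prime)]
    exact_mod_cast ha
  obtain ⟨u, v, huv⟩ := h1
  refine ⟨v, intCast_mem O3 v, u * (starRingEnd ℂ) π,
    mul_mem (intCast_mem O3 u) (conj_mem_O3 h.mem), ?_⟩
  have : (u : ℂ) * p + v * a = 1 := by exact_mod_cast huv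
  linear_combination this - u * h.norm_eq

end IsSplitPrime

theorem ECoprime.of_mul_eq_three {γ c π : ℂ} (hπ : ECong π 1 3) (hc : c ∈ O3)
    (h : γ * c = 3) : ECoprime γ π := by
  obtain ⟨d, hd, hπd⟩ := hπ
  exact ⟨-(c * d), neg_mem (mul_mem hc hd), 1, one_mem _, by linear_combination hπd - d * h⟩

theorem summable_heckeG {s : ℂ} (hs : 3 / 2 < s.re) : Summable fun ν : O3 => heckeG s ν := by
  refine Summable.of_norm_bounded (summable_O3_rpow (r := 1 - 2 * s.re) (by linarith)) fun ν => ?_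
  rcases eq_or_ne (ν : ℂ) 0 with h | h
  · rw [h, heckeG_zero, norm_zero]; positivity
  · exact (norm_heckeG h s).le

open Classical in
/-- A residue system with weights computing a function modulo `γ`. -/
structure IsWeightSystem {J : Type*} [Fintype J] (γ : ℂ) (χ' : ℂ → ℂ) (w b : J → ℂ) : Prop where
  ne_zero : γ ≠ 0
  mem : ∀ j, b j ∈ O3
  mem_gen : γ ∈ O3
  eq_sum : ∀ ν ∈ O3, χ' ν = ∑ j, if ECong ν (b j) γ then w j else 0

section
variable {p : ℕ} {π γ c : ℂ}

/-- The parametrization of the residue class of `b` modulo `γ`. -/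
def classParam (hπ : π ∈ O3) (hγ : γ ∈ O3) {b : ℂ} (hb : b ∈ O3) (x : Fin p × O3) : O3 :=
  ⟨γ * (x.1 : ℕ) + π * b + γ * π * x.2,
    add_mem (add_mem (mul_mem hγ (natCast_mem O3 _)) (mul_mem hπ hb))
      (mul_mem (mul_mem hγ hπ) x.2.2)⟩

theorem classParam_injective (h : IsSplitPrime p π) (hγ : γ ∈ O3) (hγ0 : γ ≠ 0) {b : ℂ}
    (hb : b ∈ O3) : Function.Injective (classParam (p := p) h.mem hγ hb) := by
  rintro ⟨a, μ⟩ ⟨a', μ'⟩ heq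
  have h1 : γ * ((a : ℕ) - (a' : ℕ) : ℂ) = γ * (π * (μ' - μ)) := by
    have := congrArg Subtype.val heq
    simp only [classParam] at this
    linear_combination this
  have h2 := mul_left_cancel₀ hγ0 h1
  have h3 : (a : ℕ) = a' := h.eq_of_sub_eq a.2 a'.2 (sub_mem μ'.2 μ.2) h2
  rw [h3, sub_self, eq_comm, mul_eq_zero, or_iff_right h.ne_zero, sub_eq_zero] at h2
  rw [Fin.ext h3, Subtype.ext h2]

theorem mem_range_classParam (h : IsSplitPrime p π) (hprim : ECong π 1 3) (hγ : γ ∈ O3)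
    (hc : c ∈ O3) (hγc : γ * c = 3) {b : ℂ} (hb : b ∈ O3) {ν : O3} (hν : ECong ν b γ) :
    ν ∈ Set.range (classParam (p := p) h.mem hγ hb) := by
  obtain ⟨d, hd, hd'⟩ := hν
  obtain ⟨e, he, he'⟩ := hprim
  have hκ : d - c * e * b ∈ O3 := sub_mem hd (mul_mem (mul_mem hc he) hb)
  obtain ⟨a, ha, μ, hμ, haμ⟩ := h.exists_nat_sub_eq hκ
  refine ⟨(⟨a, ha⟩, ⟨μ, hμ⟩), Subtype.ext ?_⟩
  simp only [classParam]
  linear_combination -γ * haμ - hd' + b * he' - e * b * hγc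

theorem econg_classParam (h : IsSplitPrime p π) (hprim : ECong π 1 3) (hγ : γ ∈ O3)
    (hc : c ∈ O3) (hγc : γ * c = 3) {b : ℂ} (hb : b ∈ O3) (x : Fin p × O3) :
    ECong (classParam h.mem hγ hb x : O3) b γ := by
  obtain ⟨e, he, he'⟩ := hprim
  refine ⟨(x.1 : ℕ) + c * e * b + π * x.2, add_mem (add_mem (natCast_mem O3 _)
    (mul_mem (mul_mem hc he) hb)) (mul_mem h.mem x.2.2), ?_⟩
  simp only [classParam]
  linear_combination b * he' - e * b * hγc

theorem heckeG_classParam (hπ : π ∈ O3) (hπ0 : π ≠ 0) (hγ : γ ∈ O3) (hγ0 : γ ≠ 0) {b : ℂ}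
    (hb : b ∈ O3) (x : Fin p × O3) (s : ℂ) : heckeG s (classParam hπ hγ hb x : O3) =
      heckeG s (γ * π) * heckeG s ((x.1 : ℕ) / π + b / γ + x.2) := by
  rw [← heckeG_mul]
  congr 1
  simp only [classParam]
  field_simp

theorem IsResChar3.map_classParam {χ : ℂ → ℂ} (hχ : IsResChar3 π χ) (hπ : π ∈ O3) (hγ : γ ∈ O3)
    {b : ℂ} (hb : b ∈ O3) (x : Fin p × O3) :
    χ (classParam hπ hγ hb x : O3) = χ γ * χ (x.1 : ℕ) := by
  rw [← hχ.map_mul γ hγ _ (natCast_mem O3 _)]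
  refine hχ.periodic _ (Subtype.mem _) _ (mul_mem hγ (natCast_mem O3 _)) ⟨b + γ * x.2,
    add_mem hb (mul_mem hγ x.2.2), ?_⟩
  simp only [classParam]
  ring

open Classical in
/-- Splitting of the `L`-series into residue classes. -/
theorem tsum_heckeG_eq {J : Type*} [Fintype J] {w b : J → ℂ} {χ χ' : ℂ → ℂ}
    (h : IsSplitPrime p π) (hprim : ECong π 1 3) (hc : c ∈ O3) (hγc : γ * c = 3)
    (hχ : IsResChar3 π χ) (hbdd : ∃ C : ℝ, ∀ ν ∈ O3, ‖χ ν‖ ≤ C)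
    (hsys : IsWeightSystem γ χ' w b) {s : ℂ} (hs : 3 / 2 < s.re) :
    ∑' ν : O3, χ ν * χ' ν * heckeG s ν =
      χ γ * heckeG s (γ * π) *
        ∑ a : Fin p, χ (a : ℕ) * groupedSum w (fun j => b j / γ) s ((a : ℕ) / π) := by
  have hγ := hsys.mem_gen
  have hγ0 := hsys.ne_zero
  obtain ⟨C, hC⟩ := hbdd
  set f : J → O3 → ℂ := fun j ν => χ ν * (if ECong ν (b j) γ then w j else 0) * heckeG s ν
  have hf : ∀ j, Summable (f j) := fun j => by
    refine Summable.of_norm_bounded ((summable_heckeG hs).norm.mul_left (C * ‖w j‖)) fun ν => ?_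
    have hC0 : 0 ≤ C := (norm_nonneg _).trans (hC ν ν.2)
    simp only [f, norm_mul]
    gcongr
    · exact hC ν ν.2
    · split_ifs <;> simp
  have hG : ∀ (j : J) (a : Fin p),
      Summable fun μ : O3 => heckeG s ((a : ℕ) / π + b j / γ + μ) := fun j a => by
    have h1 := (summable_heckeG hs).comp_injective
      ((classParam_injective h hγ hγ0 (hsys.mem j)).comp (Prod.mk_right_injective a))
    have h2 : (fun ν : O3 => heckeG s ν) ∘ (classParam h.mem hγ (hsys.mem j) ∘ Prod.mk a) =
        fun μ : O3 => heckeG s (γ * π) * heckeG s ((a : ℕ) / π + b j / γ + μ) := by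
      ext μ
      exact heckeG_classParam h.mem h.ne_zero hγ hγ0 (hsys.mem j) (a, μ) s
    rw [h2] at h1
    exact (summable_mul_left_iff (heckeG_ne_zero (mul_ne_zero hγ0 h.ne_zero) s)).1 h1
  have hfj : ∀ j, ∑' ν, f j ν = χ γ * heckeG s (γ * π) * ∑ a : Fin p, χ (a : ℕ) *
      ∑' μ : O3, w j * heckeG s ((a : ℕ) / π + b j / γ + μ) := fun j => by
    have hinj := classParam_injective h hγ hγ0 (hsys.mem j)
    rw [← hinj.tsum_eq (fun ν hν => mem_range_classParam h hprim hγ hc hγc (hsys.mem j) ?_)]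
    · have hprod : Summable fun x => f j (classParam h.mem hγ (hsys.mem j) x) :=
        (hf j).comp_injective hinj
      rw [hprod.tsum_prod, tsum_fintype, Finset.mul_sum]
      refine Finset.sum_congr rfl fun a _ => ?_
      rw [← mul_assoc, ← tsum_mul_left]
      refine tsum_congr fun μ => ?_
      simp only [f]
      rw [hχ.map_classParam, if_pos (econg_classParam h hprim hγ hc hγc (hsys.mem j) _),
        heckeG_classParam h.mem h.ne_zero hγ hγ0]
      ring
    · by_contra h0
      exact hν (by simp only [f, if_neg h0, mul_zero, zero_mul])
  have hsum : ∀ ν : O3, χ ν * χ' ν * heckeG s ν = ∑ j, f j ν := fun ν => by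
    rw [hsys.eq_sum ν ν.2, Finset.mul_sum, Finset.sum_mul]
  rw [tsum_congr hsum, Summable.tsum_finsetSum fun j _ => hf j,
    Finset.sum_congr rfl fun j _ => hfj j,
    ← Finset.mul_sum, Finset.sum_comm]
  congr 1
  refine Finset.sum_congr rfl fun a _ => ?_
  rw [← Finset.mul_sum, groupedSum]
  congr 1
  simp only [groupedTerm]
  rw [Summable.tsum_finsetSum fun j _ => (hG j a).mul_left _]

end

theorem econg_iff_div_mem {a b γ : ℂ} (hγ : γ ≠ 0) : ECong a b γ ↔ (a - b) / γ ∈ O3 := by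
  constructor
  · rintro ⟨d, hd, h⟩
    rwa [h, mul_div_cancel_left₀ _ hγ]
  · exact fun h => ⟨_, h, (mul_div_cancel₀ _ hγ).symm⟩

theorem sqrtm3_mul_conj : sqrtm3 * (starRingEnd ℂ) sqrtm3 = 3 := by
  rw [sqrtm3_eq]
  simp only [map_add, map_one, map_mul, map_ofNat, conj_ρ3]
  linear_combination -4 * ρ3_sq

theorem not_isUnit_sqrtm3 {x : ℂ} (hx : x ∈ O3) : sqrtm3 * x ≠ 1 := by
  intro h
  obtain ⟨n, hn⟩ := exists_int_mul_conj hx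
  have h1 : (3 : ℂ) * n = 1 := by
    rw [← hn, ← sqrtm3_mul_conj]
    calc _ = (sqrtm3 * x) * (starRingEnd ℂ) (sqrtm3 * x) := by rw [map_mul]; ring
      _ = 1 := by rw [h]; simp
  have : (3 : ℤ) * n = 1 := by exact_mod_cast h1
  omega

theorem not_coprime_of_sqrtm3_dvd {ν γ x c : ℂ} (hx : x ∈ O3) (hν : ν = sqrtm3 * x) (hc : c ∈ O3)
    (hγ : γ = sqrtm3 * c) : ¬ ECoprime ν γ := by
  rintro ⟨u, hu, v, hv, huv⟩
  refine not_isUnit_sqrtm3 (add_mem (mul_mem hu hx) (mul_mem hv hc)) ?_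
  rw [← huv, hν, hγ]; ring

theorem sqrtm3_dvd_or_econg_sixthRoot {ν : ℂ} (hν : ν ∈ O3) :
    (∃ x ∈ O3, ν = sqrtm3 * x) ∨ ∃ k : Fin 6, ECong ν (sixthRoot ^ (k : ℕ)) 3 := by
  obtain ⟨a, b, rfl⟩ := mem_O3_iff.1 hν
  have hmem : ∀ m n : ℤ, (m + n * ρ3 : ℂ) ∈ O3 := fun m n => mem_O3_iff.2 ⟨m, n, rfl⟩
  have ha : (a : ℂ) = 3 * (a / 3 : ℤ) + (a % 3 : ℤ) := by
    exact_mod_cast (Int.mul_ediv_add_emod a 3).symm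
  have hb : (b : ℂ) = 3 * (b / 3 : ℤ) + (b % 3 : ℤ) := by
    exact_mod_cast (Int.mul_ediv_add_emod b 3).symm
  have h1 : ∀ (k : Fin 6) (m n : ℤ), ((a % 3 : ℤ) : ℂ) + (b % 3 : ℤ) * ρ3 - sixthRoot ^ (k : ℕ) =
      3 * (m + n * ρ3) → ∃ k : Fin 6, ECong (a + b * ρ3) (sixthRoot ^ (k : ℕ)) 3 :=
    fun k m n h => ⟨k, _, hmem (a / 3 + m) (b / 3 + n), by
      push_cast; linear_combination h + ha + ρ3 * hb⟩
  have h2 : ∀ m n : ℤ, ((a % 3 : ℤ) : ℂ) + (b % 3 : ℤ) * ρ3 = sqrtm3 * (m + n * ρ3) →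
      ∃ x ∈ O3, (a + b * ρ3 : ℂ) = sqrtm3 * x :=
    fun m n h => ⟨-sqrtm3 * (((a / 3 : ℤ) : ℂ) + (b / 3 : ℤ) * ρ3) + (m + n * ρ3),
      add_mem (mul_mem (neg_mem sqrtm3_mem_O3)
      (hmem _ _)) (hmem _ _), by
      linear_combination h + ha + ρ3 * hb + (((a / 3 : ℤ) : ℂ) + (b / 3 : ℤ) * ρ3) * sqrtm3_sq⟩
  have hr := Int.emod_nonneg a (show (3 : ℤ) ≠ 0 by norm_num)
  have hr' := Int.emod_lt_of_pos a (show (0 : ℤ) < 3 by norm_num)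
  have hs := Int.emod_nonneg b (show (3 : ℤ) ≠ 0 by norm_num)
  have hs' := Int.emod_lt_of_pos b (show (0 : ℤ) < 3 by norm_num)
  have c3 := sixthRoot_cube
  have c2 := sixthRoot_sq_eq
  have c1 : sixthRoot = 1 + ρ3 := rfl
  have c4 : sixthRoot ^ 4 = -(1 + ρ3) := by linear_combination sixthRoot * c3 - c1
  have c5 : sixthRoot ^ 5 = -ρ3 := by linear_combination sixthRoot ^ 2 * c3 - c2
  generalize a % 3 = r at *
  generalize b % 3 = s at *
  interval_cases r <;> interval_cases s
  · exact .inl (h2 0 0 (by simp))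
  · exact .inr (h1 2 0 0 (by simp [c2]))
  · exact .inr (h1 5 0 1 (by simp [c5]; ring))
  · exact .inr (h1 0 0 0 (by simp))
  · exact .inr (h1 1 0 0 (by simp [c1]))
  · exact .inl (h2 1 0 (by rw [sqrtm3_eq]; simp))
  · exact .inr (h1 3 1 0 (by simp [c3]; ring))
  · exact .inl (h2 0 (-1) (by rw [sqrtm3_eq]; push_cast; linear_combination 2 * ρ3_sq))
  · exact .inr (h1 4 1 1 (by simp [c4]; ring))

/-- Representatives `ζ ^ k` and `-2 ζ ^ k` of the units modulo `3`. -/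
def unitRep (j : Bool × Fin 6) : ℂ := (if j.1 then 1 else -2) * sixthRoot ^ (j.2 : ℕ)

/-- Weights attached to `unitRep`. -/
def unitWeight (q θ : ℂ) (j : Bool × Fin 6) : ℂ :=
  (if j.1 then 2 / 3 else 1 / 3) * q * θ ^ (j.2 : ℕ)

theorem unitRep_mem (j : Bool × Fin 6) : unitRep j ∈ O3 := by
  refine mul_mem ?_ (pow_mem sixthRoot_mem_O3 _)
  split_ifs
  · exact one_mem _
  · exact neg_mem (ofNat_mem O3 2)

theorem exists_unitRep_eq (j : Bool × Fin 6) :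
    ∃ x ∈ O3, unitRep j = sixthRoot ^ (j.2 : ℕ) + 3 * x := by
  rcases j with ⟨_ | _, k⟩
  · exact ⟨_, neg_mem (pow_mem sixthRoot_mem_O3 k), by simp [unitRep]; ring⟩
  · exact ⟨0, zero_mem _, by simp [unitRep]⟩

theorem unitRep_div_sqrtm3_notMem (j : Bool × Fin 6) : unitRep j / sqrtm3 ∉ O3 := by
  intro h
  obtain ⟨x, hx, hj⟩ := exists_unitRep_eq j
  have hu : sixthRoot ^ (6 - (j.2 : ℕ)) * sixthRoot ^ (j.2 : ℕ) = 1 := by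
    rw [← pow_add, Nat.sub_add_cancel j.2.2.le, sixthRoot_pow_six]
  refine not_isUnit_sqrtm3 (mul_mem (pow_mem sixthRoot_mem_O3 (6 - (j.2 : ℕ)))
    (add_mem h (mul_mem sqrtm3_mem_O3 hx))) ?_
  have h1 : sqrtm3 * (unitRep j / sqrtm3) = unitRep j := mul_div_cancel₀ _ sqrtm3_ne_zero
  rw [← hu]
  linear_combination sixthRoot ^ (6 - (j.2 : ℕ)) * (h1 + hj + x * sqrtm3_sq)

theorem vanishingMoments_unitWeight {q θ : ℂ} (h6 : θ ^ 6 = 1) (h1 : θ ≠ 1) (γ : ℂ) :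
    VanishingMoments (unitWeight q θ) fun j => unitRep j / γ := by
  refine ⟨?_, ?_, ?_⟩
  · have hsum : ∑ j, unitWeight q θ j = q * (1 + θ + θ ^ 2 + θ ^ 3 + θ ^ 4 + θ ^ 5) := by
      simp only [unitWeight, Fintype.sum_prod_type, Fintype.sum_bool, Fin.sum_univ_six]
      simp; ring
    have : (θ - 1) * ∑ j, unitWeight q θ j = 0 := by
      rw [hsum]; linear_combination q * h6
    exact (mul_eq_zero.1 this).resolve_left (sub_ne_zero.2 h1)
  · simp only [unitWeight, unitRep, Fintype.sum_prod_type, Fintype.sum_bool,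
      ← Finset.sum_add_distrib]
    exact Finset.sum_eq_zero fun k _ => by simp; ring
  · simp only [unitWeight, unitRep, Fintype.sum_prod_type, Fintype.sum_bool,
      ← Finset.sum_add_distrib]
    exact Finset.sum_eq_zero fun k _ => by simp [map_ofNat]; ring

theorem pow_val_add_one {θ : ℂ} (h6 : θ ^ 6 = 1) (k : Fin 6) :
    θ ^ ((k + 1 : Fin 6) : ℕ) = θ * θ ^ (k : ℕ) := by
  rw [Fin.val_add, ← pow_eq_pow_mod _ h6, Fin.val_one, pow_succ']

theorem latticeK_unitWeight_sixthRoot {q θ : ℂ} (h6 : θ ^ 6 = 1) (γ u : ℂ) :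
    latticeK (unitWeight q θ) (fun j => unitRep j / γ) (sixthRoot * u) =
      θ * sixthRoot⁻¹ * latticeK (unitWeight q θ) (fun j => unitRep j / γ) u := by
  refine latticeK_sixthRoot ((Equiv.refl Bool).prodCongr (Equiv.addRight 1)) (fun j => ?_)
    (fun j => ?_) u
  · simp only [unitWeight, Equiv.prodCongr_apply, Prod.map, Equiv.coe_addRight, Equiv.refl_apply,
      pow_val_add_one h6]
    ring
  · simp only [unitRep, Equiv.prodCongr_apply, Prod.map, Equiv.coe_addRight, Equiv.refl_apply,
      pow_val_add_one sixthRoot_pow_six]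
    ring

open Classical in
theorem isWeightSystem_unitWeight {γ c q θ : ℂ} {χ' : ℂ → ℂ} (hγ : γ ∈ O3) (hc : c ∈ O3)
    (hγc : γ * c = 3) (hper : ∀ a ∈ O3, ∀ b ∈ O3, ECong a b γ → χ' a = χ' b)
    (hpow : ∀ k : ℕ, χ' (sixthRoot ^ k) = θ ^ k) (hzero : ∀ x ∈ O3, χ' (sqrtm3 * x) = 0)
    (hinj : ∀ k m : Fin 6, θ ^ (k : ℕ) = θ ^ (m : ℕ) →
      ECong (sixthRoot ^ (m : ℕ)) (sixthRoot ^ (k : ℕ)) γ)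
    (hq : ∀ m : Fin 6, ∑ k : Fin 6, (if θ ^ (k : ℕ) = θ ^ (m : ℕ) then q else 0) = 1)
    (hdvd : ∀ k : ℕ, θ ^ k ≠ 0) :
    IsWeightSystem γ χ' (unitWeight q θ) unitRep := by
  have hγ0 : γ ≠ 0 := by rintro rfl; norm_num at hγc
  have h3 : ∀ {a b : ℂ}, ECong a b 3 → ECong a b γ := fun {a b} ⟨d, hd, h⟩ =>
    ⟨c * d, mul_mem hc hd, by rw [h, ← hγc]; ring⟩
  refine ⟨hγ0, unitRep_mem, hγ, fun ν hν => ?_⟩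
  have hrep : ∀ j, ECong ν (unitRep j) γ ↔ χ' ν = θ ^ (j.2 : ℕ) := by
    intro j
    obtain ⟨x, hx, hj⟩ := exists_unitRep_eq j
    have hj' : χ' (unitRep j) = θ ^ (j.2 : ℕ) := by
      rw [← hpow]
      exact hper _ (unitRep_mem j) _ (pow_mem sixthRoot_mem_O3 _) (h3 ⟨x, hx, by rw [hj]; ring⟩)
    refine ⟨fun h => by rw [← hj', hper ν hν _ (unitRep_mem j) h], fun h => ?_⟩
    rcases sqrtm3_dvd_or_econg_sixthRoot hν with ⟨y, hy, rfl⟩ | ⟨m, hm⟩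
    · rw [hzero y hy] at h
      exact absurd h.symm (hdvd _)
    · have hm' : χ' ν = θ ^ (m : ℕ) := by
        rw [hper _ hν _ (pow_mem sixthRoot_mem_O3 _) (h3 hm), hpow]
      have h4 := hinj j.2 m (h.symm.trans hm')
      have h5 := h3 hm
      rw [econg_iff_div_mem hγ0] at h4 h5 ⊢
      have h6 := sub_mem (add_mem h5 h4) (mul_mem hc hx)
      convert h6 using 1
      rw [hj, ← hγc]; field_simp; ring
  simp only [hrep]
  rcases sqrtm3_dvd_or_econg_sixthRoot hν with ⟨y, hy, rfl⟩ | ⟨m, hm⟩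
  · rw [hzero y hy]
    exact (Finset.sum_eq_zero fun j _ => if_neg (hdvd _).symm).symm
  · have hm' : χ' ν = θ ^ (m : ℕ) := by
      rw [hper _ hν _ (pow_mem sixthRoot_mem_O3 _) (h3 hm), hpow]
    rw [hm', Fintype.sum_prod_type, Fintype.sum_bool, ← Finset.sum_add_distrib]
    conv_lhs => rw [← one_mul (θ ^ (m : ℕ)), ← hq m, Finset.sum_mul]
    refine Finset.sum_congr rfl fun k _ => ?_
    rcases eq_or_ne (θ ^ (k : ℕ)) (θ ^ (m : ℕ)) with h | h
    · simp only [unitWeight, h, if_true, if_false, Bool.false_eq_true]; ring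
    · simp [h, h.symm]

theorem IsCubicChar.norm_le_one {π : ℂ} {p : ℕ} {χ : ℂ → ℂ} (hχ : IsCubicChar π p χ) {ν : ℂ}
    (hν : ν ∈ O3) : ‖χ ν‖ ≤ 1 := by
  by_cases h : ECoprime ν π
  · have h3 : ‖χ ν‖ ^ 3 = 1 := by rw [← norm_pow, hχ.cube ν hν h, norm_one]
    exact ((pow_eq_one_iff_of_nonneg (norm_nonneg _) (by norm_num)).1 h3).le
  · rw [hχ.resChar.vanish ν hν h, norm_zero]; exact zero_le_one

/-- The central value of the `L`-series as a finite sum of values of an elliptic function. -/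
theorem IsLValue3.eq_sum_latticeK {J : Type*} [Fintype J] {w b : J → ℂ} {χ χ' : ℂ → ℂ}
    {p : ℕ} {π γ c L : ℂ} (h : IsSplitPrime p π) (hprim : ECong π 1 3) (hc : c ∈ O3)
    (hγc : γ * c = 3) (hχ : IsCubicChar π p χ) (hsys : IsWeightSystem γ χ' w b)
    (hmom : VanishingMoments w fun j => b j / γ) (hL : IsLValue3 (fun ν => χ ν * χ' ν) L) :
    L = 1 / 6 * (χ γ * heckeG 1 (γ * π) *
      ∑ a : Fin p, χ (a : ℕ) * latticeK w (fun j => b j / γ) ((a : ℕ) / π)) := by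
  obtain ⟨F, hF, hFs, rfl⟩ := hL
  refine eq_at_one_of_eq_on_re_gt (F := F) (R := fun s => 1 / 6 * (χ γ * heckeG s (γ * π) *
    ∑ a : Fin p, χ (a : ℕ) * groupedSum w (fun j => b j / γ) s ((a : ℕ) / π))) hF ?_ fun s hs => ?_
  · refine (((differentiable_heckeG _).differentiableOn.const_mul _).mul ?_).const_mul _
    exact DifferentiableOn.fun_sum fun a _ => (hmom.differentiableOn _ _).const_mul _
  · rw [hFs s hs, ← tsum_heckeG_eq h hprim hc hγc hχ.resChar ⟨1, fun ν hν => hχ.norm_le_one hν⟩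
      hsys hs]
    simp only [heckeG, mul_assoc]

section
variable {q θ : ℂ}

open Classical in
theorem order_latticeK_unitWeight_ne_top {γ : ℂ} {χ' : ℂ → ℂ}
    (hsys : IsWeightSystem γ χ' (unitWeight q θ) unitRep)
    (hmom : VanishingMoments (unitWeight q θ) fun j => unitRep j / γ) (h1 : χ' 1 = 1) :
    meromorphicOrderAt (latticeK (unitWeight q θ) fun j => unitRep j / γ) (-(1 / γ)) ≠ ⊤ := by
  refine hmom.order_latticeK_ne_top ?_
  have : ∑ j, (if -(1 / γ) + unitRep j / γ ∈ O3 then unitWeight q θ j else 0) = 1 := by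
    refine Eq.trans ?_ ((hsys.eq_sum 1 (one_mem _)).symm.trans h1)
    refine Finset.sum_congr rfl fun j _ => ?_
    have : -(1 / γ) + unitRep j / γ = -((1 - unitRep j) / γ) := by ring
    rw [this, neg_mem_iff, ← econg_iff_div_mem hsys.ne_zero]
  rw [this]; exact one_ne_zero

theorem sqrtm3_mul_notMem_of_add_unitRep {z : ℂ} {j : Bool × Fin 6}
    (h : z + unitRep j / sqrtm3 ∈ O3) : z ∉ O3 ∧ sqrtm3 * z ∈ O3 := by
  refine ⟨fun hz => unitRep_div_sqrtm3_notMem j ?_, ?_⟩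
  · simpa using sub_mem h hz
  · have := sub_mem (mul_mem sqrtm3_mem_O3 h) (unitRep_mem j)
    convert this using 1
    field_simp [sqrtm3_ne_zero]; ring

theorem three_mul_mem_of_add_unitRep {z : ℂ} {j : Bool × Fin 6}
    (h : z + unitRep j / 3 ∈ O3) : sqrtm3 * z ∉ O3 ∧ 3 * z ∈ O3 := by
  have h1 : -(sqrtm3 * z) + unitRep j / sqrtm3 = -sqrtm3 * (z + unitRep j / 3) := by
    field_simp [sqrtm3_ne_zero]
    linear_combination unitRep j * sqrtm3_sq
  obtain ⟨h2, h3⟩ := sqrtm3_mul_notMem_of_add_unitRep (z := -(sqrtm3 * z)) (j := j)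
    (h1 ▸ mul_mem (neg_mem sqrtm3_mem_O3) h)
  refine ⟨fun h4 => h2 (neg_mem h4), ?_⟩
  rwa [mul_neg, neg_mem_iff, sqrtm3_mul_sqrtm3_mem] at h3

end

section
variable {χ₀ : ℂ → ℂ}

theorem IsChi0'₃.map_sixthRoot_pow (h : IsChi0'₃ χ₀) (k : ℕ) :
    χ₀ (sixthRoot ^ k) = (-1) ^ k := by
  have h1 : χ₀ sixthRoot = -1 := by
    rw [← h.2]
    refine h.1.periodic _ sixthRoot_mem_O3 _ (neg_mem (one_mem _)) ⟨-ρ3, neg_mem ρ3_mem_O3, ?_⟩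
    rw [sixthRoot, sqrtm3_eq]; linear_combination 2 * ρ3_sq
  induction k with
  | zero => simpa using h.1.map_one
  | succ k ih =>
    rw [pow_succ, h.1.map_mul _ (pow_mem sixthRoot_mem_O3 k) _ sixthRoot_mem_O3, ih, h1, pow_succ]

theorem IsChi0₃.map_sixthRoot_pow (h : IsChi0₃ χ₀) (k : ℕ) :
    χ₀ (sixthRoot ^ k) = sixthRoot ^ k := by
  have h1 : χ₀ sixthRoot = sixthRoot := by
    refine h.2 _ ?_
    have : sixthRoot = -ρ3 ^ 2 := by rw [ρ3_sq, sixthRoot]; ring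
    simp [this]
  induction k with
  | zero => simpa using h.1.map_one
  | succ k ih =>
    rw [pow_succ, h.1.map_mul _ (pow_mem sixthRoot_mem_O3 k) _ sixthRoot_mem_O3, ih, h1]

theorem sqrtm3_mul_neg_sqrtm3 : sqrtm3 * -sqrtm3 = 3 := by linear_combination -sqrtm3_sq

theorem IsChi0'₃.isWeightSystem (h : IsChi0'₃ χ₀) :
    IsWeightSystem sqrtm3 χ₀ (unitWeight (1 / 3) (-1)) unitRep := by
  refine isWeightSystem_unitWeight sqrtm3_mem_O3 (neg_mem sqrtm3_mem_O3) sqrtm3_mul_neg_sqrtm3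
    h.1.periodic h.map_sixthRoot_pow (fun x hx => h.1.vanish _ (mul_mem sqrtm3_mem_O3 hx)
      (not_coprime_of_sqrtm3_dvd hx rfl (one_mem _) (mul_one _).symm)) (fun k m hkm => ?_)
    (fun m => ?_) fun k => by simp
  · have key : ∀ n : ℕ, (sixthRoot ^ n - (-1) ^ n) / sqrtm3 ∈ O3 := fun n => by
      rw [← econg_iff_div_mem sqrtm3_ne_zero]
      obtain ⟨x, hx⟩ := sub_dvd_pow_sub_pow (⟨sixthRoot, sixthRoot_mem_O3⟩ : O3) (-1) n
      have hx' := congrArg Subtype.val hx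
      push_cast at hx'
      refine ⟨-ρ3 * x, mul_mem (neg_mem ρ3_mem_O3) x.2, ?_⟩
      rw [hx', sixthRoot, sqrtm3_eq]; linear_combination (2 * x : ℂ) * ρ3_sq
    rw [econg_iff_div_mem sqrtm3_ne_zero]
    have := sub_mem (key m) (key k)
    rw [hkm] at this
    convert this using 1
    ring
  · fin_cases m <;> simp [Fin.sum_univ_six] <;> norm_num

theorem IsChi0₃.isWeightSystem (h : IsChi0₃ χ₀) :
    IsWeightSystem 3 (fun ν => (starRingEnd ℂ) (χ₀ ν)) (unitWeight 1 sixthRoot⁻¹) unitRep := by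
  have hinj : ∀ k m : Fin 6, sixthRoot⁻¹ ^ (k : ℕ) = sixthRoot⁻¹ ^ (m : ℕ) → k = m := by
    intro k m hkm
    have h1 : sixthRoot ^ ((k : ℤ) - m) = 1 := by
      rw [inv_pow, inv_pow, inv_inj] at hkm
      rw [zpow_sub₀ sixthRoot_ne_zero, zpow_natCast, zpow_natCast, hkm,
        div_self (pow_ne_zero _ sixthRoot_ne_zero)]
    rw [sixthRoot_zpow_eq_one_iff] at h1
    omega
  refine isWeightSystem_unitWeight (ofNat_mem O3 3) (one_mem _) (mul_one _)
    (fun a ha b hb hab => by rw [h.1.periodic a ha b hb hab])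
    (fun k => by rw [h.map_sixthRoot_pow, map_pow, conj_sixthRoot])
    (fun x hx => by rw [h.1.vanish _ (mul_mem sqrtm3_mem_O3 hx) (not_coprime_of_sqrtm3_dvd hx rfl
      (neg_mem sqrtm3_mem_O3) sqrtm3_mul_neg_sqrtm3.symm), map_zero]) (fun k m hkm => ?_)
    (fun m => ?_) fun k => pow_ne_zero _ (inv_ne_zero sixthRoot_ne_zero)
  · rw [hinj k m hkm]
    exact ⟨0, zero_mem _, by ring⟩
  · rw [Finset.sum_eq_single m (fun k _ hk => if_neg fun hkm => hk (hinj k m hkm)) (by simp),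
      if_pos rfl]

end

section
variable {p : ℕ} {π : ℂ}

theorem IsChi0'₃.exists_lvalue_eq_sum {χ₀ : ℂ → ℂ} (hχ₀ : IsChi0'₃ χ₀) (h : IsSplitPrime p π)
    (hprim : ECong π 1 3) :
    ∃ K : ℂ → ℂ, (∃ C ≠ 0, ∀ u, sqrtm3 * u ∉ O3 → K u * wpE u = C) ∧
      ∀ χ L, IsCubicChar π p χ → IsLValue3 (fun ν => χ ν * χ₀ ν) L →
        L = 1 / 6 * (χ sqrtm3 * heckeG 1 (sqrtm3 * π) *
          ∑ a : Fin p, χ (a : ℕ) * K ((a : ℕ) / π)) := by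
  have hsys := hχ₀.isWeightSystem
  have hmom := vanishingMoments_unitWeight (q := 1 / 3) (θ := -1) (by norm_num) (by norm_num) sqrtm3
  refine ⟨_, exists_mul_wpE_eq_const hmom.latticeK_meromorphic
    (fun z w hw => latticeK_periodic z hw) (fun u => ?_) hmom.neg_one_le_order_latticeK
    (fun z hz => hmom.analyticAt_latticeK fun j hj => hz (sqrtm3_mul_notMem_of_add_unitRep hj))
    (order_latticeK_unitWeight_ne_top hsys hmom hχ₀.1.map_one), fun χ L hχ hL =>
    hL.eq_sum_latticeK h hprim (neg_mem sqrtm3_mem_O3) sqrtm3_mul_neg_sqrtm3 hχ hsys hmom⟩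
  rw [latticeK_unitWeight_sixthRoot (by norm_num)]
  congr 1
  have := sixthRoot_ne_zero
  have h3 := sixthRoot_cube
  rw [show (2 : ℤ) = ((2 : ℕ) : ℤ) by rfl, zpow_natCast]
  field_simp
  linear_combination -h3

theorem IsChi0₃.exists_lvalue_eq_sum {χ₀ : ℂ → ℂ} (hχ₀ : IsChi0₃ χ₀) (h : IsSplitPrime p π)
    (hprim : ECong π 1 3) :
    ∃ K : ℂ → ℂ, (∃ C ≠ 0, ∀ u, 3 * u ∉ O3 → K u * wpE u * wpE (sqrtm3 * u) = C) ∧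
      ∀ χ L, IsCubicChar π p χ → IsLValue3 (fun ν => χ ν * (starRingEnd ℂ) (χ₀ ν)) L →
        L = 1 / 6 * (χ 3 * heckeG 1 (3 * π) *
          ∑ a : Fin p, χ (a : ℕ) * K ((a : ℕ) / π)) := by
  have hsys := hχ₀.isWeightSystem
  have h6 : sixthRoot⁻¹ ^ 6 = 1 := by rw [inv_pow, sixthRoot_pow_six, inv_one]
  have hne : sixthRoot⁻¹ ≠ 1 := fun h => by
    have := sixthRoot_cube
    rw [inv_eq_one.1 h] at this
    norm_num at this
  have hmom := vanishingMoments_unitWeight (q := 1) h6 hne 3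
  refine ⟨_, exists_mul_wpE_mul_wpE_eq_const hmom.latticeK_meromorphic
    (fun z w hw => latticeK_periodic z hw) (fun u => ?_) hmom.neg_one_le_order_latticeK
    (fun z hz => hmom.analyticAt_latticeK fun j hj => hz (three_mul_mem_of_add_unitRep hj))
    (order_latticeK_unitWeight_ne_top hsys hmom (by simp [hχ₀.1.map_one])), fun χ L hχ hL =>
    hL.eq_sum_latticeK h hprim (one_mem _) (mul_one _) hχ hsys hmom⟩
  rw [latticeK_unitWeight_sixthRoot h6]
  congr 1
  have := sixthRoot_ne_zero
  have h6' := sixthRoot_pow_six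
  rw [show (4 : ℤ) = ((4 : ℕ) : ℤ) by rfl, zpow_natCast]
  field_simp
  exact h6'.symm

end

theorem exists_valuation_three_lt_one : ∃ B : ValuationSubring ℂ, B.valuation 3 < 1 := by
  obtain ⟨B, -, hB⟩ := Ideal.image_subset_nonunits_valuationSubring (K := ℂ)
    (A := (Int.castRingHom ℂ).range) (Ideal.span {3}) (by
      rw [Ne, Ideal.span_singleton_eq_top]
      rintro h
      obtain ⟨⟨_, n, rfl⟩, hn⟩ := h.exists_right_inv
      have h1 : (3 : ℂ) * n = 1 := congrArg Subtype.val hn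
      have h2 : (3 : ℤ) * n = 1 := by exact_mod_cast h1
      omega)
  exact ⟨B, B.mem_nonunits_iff.1
    (hB ⟨3, Ideal.mem_span_singleton_self 3, rfl⟩)⟩

section
variable {K Γ : Type*} [Field K] [LinearOrderedCommGroupWithZero Γ] (v : Valuation K Γ)

theorem Valuation.eq_one_of_sub_one_lt_one {x : K} (hx : v (x - 1) < 1) : v x = 1 := by
  have h := v.map_one_add_of_lt hx
  rwa [add_sub_cancel] at h

theorem Valuation.mul_sub_one_lt_one {x y : K} (hx : v (x - 1) < 1) (hy : v (y - 1) < 1) :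
    v (x * y - 1) < 1 := by
  have h : x * y - 1 = (x - 1) * y + (y - 1) := by ring
  rw [h]
  exact v.map_add_lt (by rwa [map_mul, v.eq_one_of_sub_one_lt_one hy, mul_one]) hy

theorem Valuation.inv_sub_one_lt_one {x : K} (hx : v (x - 1) < 1) : v (x⁻¹ - 1) < 1 := by
  have h1 := v.eq_one_of_sub_one_lt_one hx
  have h0 : x ≠ 0 := fun h => by rw [h, map_zero] at h1; exact zero_ne_one h1
  have h : x⁻¹ - 1 = -(x - 1) * x⁻¹ := by field_simp; ring
  rwa [h, map_mul, Valuation.map_neg, map_inv₀, h1, inv_one, mul_one]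

theorem Valuation.sub_one_lt_one_of_pow_three {x : K} (h3 : v 3 < 1) (hx : v x ≤ 1)
    (h : v (x ^ 3 - 1) < 1) : v (x - 1) < 1 := by
  have h1 : (x - 1) ^ 3 = (x ^ 3 - 1) + 3 * (x * (1 - x)) := by ring
  have h2 : v (x * (1 - x)) ≤ 1 := by
    rw [map_mul]
    exact mul_le_one' hx (v.map_sub_le (map_one v).le hx)
  have h4 : v ((x - 1) ^ 3) < 1 := by
    rw [h1]
    refine v.map_add_lt h ?_
    rw [map_mul]
    exact mul_lt_one_of_lt_of_le h3 h2
  rw [map_pow] at h4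
  exact (pow_lt_one_iff (by norm_num)).1 h4

/-- Points of a finite orbit under `3 x' x ^ 2 + x ^ 3 = 1` are congruent to `1`. -/
theorem Valuation.sub_one_lt_one_of_orbit (h3 : v 3 < 1) {x : ℕ → K}
    (hfin : (Set.range x).Finite) (hx : ∀ n, 3 * x (n + 1) * x n ^ 2 + x n ^ 3 = 1) :
    v (x 0 - 1) < 1 := by
  have hstep : ∀ n, 1 < v (x n) → v (x n) < v (x (n + 1)) := fun n hn => by
    have h0 : v (x n) ≠ 0 := (zero_lt_one.trans hn).ne'
    have h1 : v (3 * x (n + 1) * x n ^ 2) = v (x n ^ 3) := by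
      have : 3 * x (n + 1) * x n ^ 2 = 1 - x n ^ 3 := by rw [← hx n]; ring
      rw [this, v.map_sub_eq_of_lt_right]
      rw [map_one, map_pow]
      exact one_lt_pow₀ hn three_ne_zero
    have h2 : v 3 * v (x (n + 1)) = v (x n) := by
      refine mul_right_cancel₀ (pow_ne_zero 2 h0) ?_
      rw [← map_mul, ← map_pow, ← map_mul, h1, map_pow, map_pow, pow_succ']
    rw [← h2]
    refine mul_lt_of_lt_one_left (zero_lt_iff.2 fun h => h0 ?_) h3
    rw [← h2, h, mul_zero]
  have hle : ∀ n, v (x n) ≤ 1 := fun n => by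
    by_contra! hn
    have hgt : ∀ k, 1 < v (x (n + k)) := fun k => by
      induction k with
      | zero => exact hn
      | succ k ih => exact ih.trans (hstep _ ih)
    have hmono : StrictMono fun k => v (x (n + k)) :=
      strictMono_nat_of_lt_succ fun k => hstep _ (hgt k)
    have hinj : Function.Injective fun k => x (n + k) := fun a b hab =>
      hmono.injective (congrArg v hab)
    exact Set.infinite_range_of_injective hinj
      (hfin.subset (Set.range_subset_iff.2 fun k => ⟨n + k, rfl⟩))
  refine v.sub_one_lt_one_of_pow_three h3 (hle 0) ?_
  have : x 0 ^ 3 - 1 = -(3 * (x 1 * x 0 ^ 2)) := by rw [← hx 0]; ring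
  rw [this, Valuation.map_neg, map_mul, map_mul, map_pow]
  exact mul_lt_one_of_lt_of_le h3 (mul_le_one' (hle 1) (pow_le_one' (hle 0) 2))

end

/-- A normalization of `℘` taking values congruent to `1` modulo `3` at torsion points of order
prime to `3`. -/
theorem exists_wpE_div_sub_one_lt_one :
    ∃ κ : ℂ, κ ≠ 0 ∧ ∀ (B : ValuationSubring ℂ), B.valuation 3 < 1 → ∀ u : ℂ,
      (∀ n : ℕ, sqrtm3 ^ n * u ∉ O3) → (Set.range fun n : ℕ => wpE (sqrtm3 ^ n * u)).Finite →
      B.valuation (wpE u / κ - 1) < 1 := by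
  obtain ⟨b, hb, h⟩ := exists_wpE_sqrtm3_mul
  obtain ⟨κ, hκ⟩ := IsAlgClosed.exists_pow_nat_eq (-b) (show 0 < 3 by norm_num)
  have hκ0 : κ ≠ 0 := by
    rintro rfl
    exact hb (by simpa using hκ.symm)
  refine ⟨κ, hκ0, fun B h3 u hu hfin => ?_⟩
  have := B.valuation.sub_one_lt_one_of_orbit h3
    (x := fun n => wpE (sqrtm3 ^ n * u) / κ) (by
      have := hfin.image (· / κ)
      rwa [← Set.range_comp] at this) fun n => by
    have h1 := h (sqrtm3 ^ n * u) (by rw [← mul_assoc, ← pow_succ']; exact hu (n + 1))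
    rw [← mul_assoc, ← pow_succ'] at h1
    generalize wpE (sqrtm3 ^ (n + 1) * u) = y at *
    generalize wpE (sqrtm3 ^ n * u) = x at *
    field_simp
    rw [hκ]
    linear_combination -h1
  simpa using this

/-- A permutation of order three without fixed points has a transversal of its orbits. -/
theorem exists_sum_eq_three_mul {α : Type*} [Fintype α] (σ : Equiv.Perm α)
    (h3 : ∀ a, σ (σ (σ a)) = a) (hfix : ∀ a, σ a ≠ a) :
    ∃ R : Finset α, ∀ {M : Type} [CommSemiring M] (F : α → M), (∀ a, F (σ a) = F a) →
      ∑ a, F a = 3 * ∑ a ∈ R, F a := by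
  classical
  let e := Fintype.equivFin α
  let P : α → Prop := fun a => e a < e (σ a) ∧ e a < e (σ (σ a))
  refine ⟨Finset.univ.filter P, fun {M} _ F hF => ?_⟩
  have hsplit : ∀ a, F a = (if P a then F a else 0) + (if P (σ a) then F (σ a) else 0) +
      (if P (σ (σ a)) then F (σ (σ a)) else 0) := fun a => by
    have n1 : e a ≠ e (σ a) := fun h => hfix a (e.injective h).symm
    have n2 : e (σ a) ≠ e (σ (σ a)) := fun h => hfix (σ a) (e.injective h).symm
    have n3 : e (σ (σ a)) ≠ e a := fun h => hfix (σ (σ a)) ((h3 a).trans (e.injective h).symm)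
    simp only [P, h3, hF]
    rcases lt_or_gt_of_ne n1 with h1 | h1 <;> rcases lt_or_gt_of_ne n2 with h2 | h2 <;>
      rcases lt_or_gt_of_ne n3 with h3 | h3 <;>
      first
        | exact absurd (h1.trans (h2.trans h3)) (lt_irrefl _)
        | exact absurd (h1.trans (h3.trans h2)) (lt_irrefl _)
        | simp [h1, h2, h3, h1.not_gt, h2.not_gt, h3.not_gt]
  have hσ : ∀ G : α → M, ∑ a, G (σ a) = ∑ a, G a := fun G => Equiv.sum_comp σ G
  rw [Finset.sum_congr rfl fun a _ => hsplit a, Finset.sum_add_distrib, Finset.sum_add_distrib,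
    hσ fun a => if P (σ a) then F (σ a) else 0, hσ fun a => if P a then F a else 0,
    Finset.sum_filter]
  ring

theorem ValuationSubring.sum_ne_zero {α : Type*} (B : ValuationSubring ℂ)
    (h3 : B.valuation 3 < 1) {R : Finset α} {F : α → ℂ}
    (hF : ∀ a ∈ R, B.valuation (F a - 1) < 1) (hR : ¬ 3 ∣ R.card) : ∑ a ∈ R, F a ≠ 0 := by
  intro h0
  have h1 : B.valuation (R.card : ℂ) < 1 := by
    have h2 : (R.card : ℂ) = -∑ a ∈ R, (F a - 1) := by
      rw [Finset.sum_sub_distrib, h0]; simp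
    rw [h2, Valuation.map_neg]
    exact B.valuation.map_sum_lt one_ne_zero hF
  have hint : ∀ n : ℤ, B.valuation (n : ℂ) ≤ 1 := fun n =>
    (B.valuation_le_one_iff _).2 (intCast_mem B n)
  obtain ⟨u, v, huv⟩ := (Nat.isCoprime_iff_coprime.2
    ((Nat.Prime.coprime_iff_not_dvd Nat.prime_three).2 hR))
  have h4 : (u : ℂ) * 3 + v * (R.card : ℂ) = 1 := by exact_mod_cast huv
  have h5 : B.valuation ((u : ℂ) * 3 + v * (R.card : ℂ)) < 1 := by
    refine B.valuation.map_add_lt ?_ ?_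
    · rw [map_mul, mul_comm]; exact mul_lt_one_of_lt_of_le h3 (hint u)
    · rw [map_mul, mul_comm]; exact mul_lt_one_of_lt_of_le h1 (hint v)
  rw [h4, map_one] at h5
  exact lt_irrefl _ h5

theorem sum_fin_eq_sum_units {p : ℕ} [Fact p.Prime] {f : ℕ → ℂ} (h0 : f 0 = 0) :
    ∑ a : Fin p, f a = ∑ u : (ZMod p)ˣ, f (u : ZMod p).val := by
  have h1 : ∑ a : Fin p, f a = ∑ x : ZMod p, f x.val := by
    have hp := (Fact.out : p.Prime).ne_zero
    cases p with
    | zero => exact absurd rfl hp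
    | succ n => rfl
  rw [h1]
  symm
  refine Fintype.sum_of_injective (fun u : (ZMod p)ˣ => (u : ZMod p)) Units.val_injective _ _
    (fun x hx => ?_) fun _ => rfl
  have : x = 0 := by
    by_contra hne
    exact hx ⟨Units.mk0 x hne, rfl⟩
  rw [this, ZMod.val_zero, h0]

namespace IsSplitPrime
variable {p : ℕ} {π : ℂ}

theorem econg_intCast (h : IsSplitPrime p π) {m n : ℤ} (hmn : (p : ℤ) ∣ m - n) :
    ECong m n π := by
  obtain ⟨k, hk⟩ := hmn
  refine ⟨(starRingEnd ℂ) π * k, mul_mem (conj_mem_O3 h.mem) (intCast_mem O3 k), ?_⟩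
  rw [← mul_assoc, ← h.norm_eq]
  exact_mod_cast hk

theorem eq_of_econg_of_cube_eq_one (h : IsSplitPrime p π) (hp3 : p % 3 = 1) {x y : ℂ}
    (hx : x ^ 3 = 1) (hy : y ^ 3 = 1) (hxy : ECong x y π) : x = y := by
  obtain ⟨μ, hμ, hμ'⟩ := hxy
  by_contra hne
  have h1 : x ^ 2 + x * y + y ^ 2 = 0 := by
    refine mul_left_cancel₀ (sub_ne_zero.2 hne) ?_
    linear_combination hx - hy
  have h2 : (x - y) ^ 2 = -3 * (x * y) := by linear_combination h1
  have h3 : (x - y) ^ 6 = -27 := by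
    have : (x - y) ^ 6 = ((x - y) ^ 2) ^ 3 := by ring
    rw [this, h2]
    have : (-3 * (x * y)) ^ 3 = -27 * (x ^ 3 * y ^ 3) := by ring
    rw [this, hx, hy]; ring
  have h4 : (p : ℤ) ∣ -27 := by
    refine h.dvd_of_intCast_eq (μ := π ^ 5 * μ ^ 6)
      (mul_mem (pow_mem h.mem 5) (pow_mem hμ 6)) ?_
    push_cast
    rw [← h3, hμ']; ring
  have h5 : p ∣ 3 ^ 3 := by
    rw [Int.dvd_neg] at h4
    exact_mod_cast h4
  have h6 := (Nat.prime_dvd_prime_iff_eq h.prime Nat.prime_three).1 (h.prime.dvd_of_dvd_pow h5)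
  omega

theorem coprime_ρ3 : ECoprime ρ3 π :=
  ⟨ρ3 ^ 2, pow_mem ρ3_mem_O3 2, 0, zero_mem _, by linear_combination ρ3_cube⟩

theorem cubicChar_ρ3 (h : IsSplitPrime p π) (hp3 : p % 3 = 1) {χ : ℂ → ℂ}
    (hχ : IsCubicChar π p χ) : χ ρ3 = ρ3 ^ ((p - 1) / 3) :=
  h.eq_of_econg_of_cube_eq_one hp3 (hχ.cube _ ρ3_mem_O3 coprime_ρ3)
    (by rw [← pow_mul, mul_comm, pow_mul, ρ3_cube, one_pow]) (hχ.euler _ ρ3_mem_O3 coprime_ρ3)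

theorem sum_mul_ne_zero (h : IsSplitPrime p π) (hp3 : p % 3 = 1) (hp9 : p % 9 ≠ 1) {χ k : ℂ → ℂ}
    (hχ : IsCubicChar π p χ) (hper : ∀ z, ∀ w ∈ O3, k (z + w) = k z)
    (hrot : ∀ u, χ ρ3 * k (ρ3 * u) = k u) {B : ValuationSubring ℂ} (h3 : B.valuation 3 < 1)
    (hk : ∀ a : ℕ, ¬ p ∣ a → B.valuation (k (a / π) - 1) < 1) :
    ∑ a : Fin p, χ (a : ℕ) * k ((a : ℕ) / π) ≠ 0 := by
  have : Fact p.Prime := ⟨h.prime⟩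
  set g : ℂ → ℂ := fun ν => χ ν * k (ν / π)
  have hg : ∀ a ∈ O3, ∀ b ∈ O3, ECong a b π → g a = g b := fun a ha b hb hab => by
    simp only [g]
    rw [hχ.resChar.periodic a ha b hb hab]
    obtain ⟨d, hd, h1⟩ := hab
    have h2 : a / π = b / π + d := by
      field_simp [h.ne_zero]; linear_combination h1
    rw [h2, hper _ _ hd]
  have hgρ : ∀ a ∈ O3, g (ρ3 * a) = g a := fun a ha => by
    simp only [g]
    rw [hχ.resChar.map_mul _ ρ3_mem_O3 _ ha, mul_div_assoc, mul_comm (χ ρ3), mul_assoc, hrot]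
  obtain ⟨r, hr⟩ := h.exists_int_ρ3
  have hr3 : ((r : ZMod p)) ^ 2 + r + 1 = 0 := by
    obtain ⟨d, hd, h1⟩ := hr
    have : (p : ℤ) ∣ r ^ 2 + r + 1 := by
      refine h.dvd_of_intCast_eq (μ := -d * (ρ3 + r + 1)) (mul_mem (neg_mem hd)
        (add_mem (add_mem ρ3_mem_O3 (intCast_mem O3 r)) (one_mem _))) ?_
      push_cast
      linear_combination ρ3_sq - (ρ3 + r + 1) * h1
    exact_mod_cast (ZMod.intCast_zmod_eq_zero_iff_dvd _ p).2 this
  have hr0 : (r : ZMod p) ^ 3 = 1 := by linear_combination ((r : ZMod p) - 1) * hr3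
  have hr1 : (r : ZMod p) ≠ 1 := fun h1 => by
    rw [h1] at hr3
    have h4 : ((3 : ℕ) : ZMod p) = 0 := by push_cast; linear_combination hr3
    rw [ZMod.natCast_eq_zero_iff] at h4
    have := (Nat.prime_dvd_prime_iff_eq h.prime Nat.prime_three).1 h4
    omega
  set ω : (ZMod p)ˣ := Units.mk0 (r : ZMod p) fun h1 => by
    rw [h1] at hr0; norm_num at hr0
  have hω3 : ω * (ω * ω) = 1 := Units.ext (by
    simp only [Units.val_mul, ω, Units.val_mk0, Units.val_one]; linear_combination hr0)
  obtain ⟨R, hR⟩ := exists_sum_eq_three_mul (Equiv.mulLeft ω)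
    (fun a => by
      simp only [Equiv.coe_mulLeft]
      rw [← mul_assoc, ← mul_assoc, mul_assoc ω, hω3, one_mul])
    (fun a h1 => hr1 (by
      rw [Equiv.coe_mulLeft, mul_eq_right] at h1
      simpa [ω] using congrArg Units.val h1))
  have hcard : p - 1 = 3 * R.card := by
    have := hR (M := ℕ) (fun _ => 1) fun _ => rfl
    simpa [ZMod.card_units_eq_totient, Nat.totient_prime h.prime] using this
  have hp1 := h.prime.one_lt
  have hg0 : g 0 = 0 := by
    simp only [g]
    rw [hχ.resChar.vanish 0 (zero_mem _) h.not_coprime_zero, zero_mul]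
  rw [sum_fin_eq_sum_units (f := fun a => g (a : ℕ)) (by simpa using hg0), hR]
  · refine mul_ne_zero three_ne_zero (B.sum_ne_zero h3 (fun u _ => ?_) (by omega))
    have hu : ¬ p ∣ (u : ZMod p).val := by
      rw [← ZMod.natCast_eq_zero_iff, ZMod.natCast_zmod_val]
      exact u.ne_zero
    refine B.valuation.mul_sub_one_lt_one ?_ (hk _ hu)
    refine B.valuation.sub_one_lt_one_of_pow_three h3 ?_ ?_
    · have := hχ.cube _ (natCast_mem O3 _) (h.coprime_natCast hu)
      refine (pow_le_one_iff (n := 3) (by norm_num)).1 ?_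
      rw [← map_pow, this, map_one]
    · rw [hχ.cube _ (natCast_mem O3 _) (h.coprime_natCast hu), sub_self, map_zero]
      exact zero_lt_one
  · intro u
    rw [← hgρ (u : ZMod p).val (natCast_mem O3 _)]
    refine hg _ (natCast_mem O3 _) _ (mul_mem ρ3_mem_O3 (natCast_mem O3 _)) ?_
    have h1 : (p : ℤ) ∣ (((ω * u : (ZMod p)ˣ) : ZMod p).val : ℤ) - r * ((u : ZMod p).val : ℤ) := by
      rw [← ZMod.intCast_zmod_eq_zero_iff_dvd]
      push_cast
      simp [ω]
    have h2 := h.econg_intCast h1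
    rw [econg_iff_div_mem h.ne_zero] at h2 hr ⊢
    have h4 := sub_mem h2 (mul_mem hr (natCast_mem O3 (u : ZMod p).val))
    convert h4 using 1
    simp only [Equiv.coe_mulLeft]
    push_cast
    ring

theorem sqrtm3_pow_mul_div_notMem (h : IsSplitPrime p π) (hp3 : p % 3 = 1) {a : ℕ} (ha : ¬ p ∣ a)
    (n : ℕ) : sqrtm3 ^ n * (a / π) ∉ O3 := by
  intro hmem
  have h1 : (p : ℤ) ∣ ((3 ^ n * (a * a) : ℕ) : ℤ) := by
    refine h.dvd_of_mul_conj_eq (z := sqrtm3 ^ n * a) hmem ?_ ?_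
    · field_simp [h.ne_zero]
    · push_cast
      rw [← sqrtm3_mul_conj, mul_pow]
      simp only [map_mul, map_pow, map_natCast]
      ring
  rw [Int.natCast_dvd_natCast, h.prime.dvd_mul, h.prime.dvd_mul, or_self, or_iff_left ha] at h1
  have h2 := (Nat.prime_dvd_prime_iff_eq h.prime Nat.prime_three).1 (h.prime.dvd_of_dvd_pow h1)
  omega

theorem finite_range_wpE (h : IsSplitPrime p π) {ν : ℕ → ℂ} (hν : ∀ n, ν n ∈ O3) :
    (Set.range fun n => wpE (ν n / π)).Finite := by
  refine (Set.finite_range fun a : Fin p => wpE ((a : ℕ) / π)).subset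
    (Set.range_subset_iff.2 fun n => ?_)
  obtain ⟨a, ha, μ, hμ, h1⟩ := h.exists_nat_sub_eq (hν n)
  refine ⟨⟨a, ha⟩, ?_⟩
  have h2 : ν n / π = a / π + μ := by
    field_simp [h.ne_zero]; linear_combination h1
  simp only [h2]
  rw [wpE_periodic _ _ hμ]

end IsSplitPrime

theorem wpE_ρ3 (u : ℂ) : wpE (ρ3 * u) = ρ3 * wpE u := by
  rw [← sixthRoot_sq_eq, pow_two, mul_assoc, wpE_sixthRoot, wpE_sixthRoot,
    show (4 : ℤ) = ((4 : ℕ) : ℤ) by rfl, zpow_natCast]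
  linear_combination sixthRoot ^ 2 * wpE u * sixthRoot_pow_six

section
variable {p : ℕ} {π L C : ℂ} {χ χ₀ : ℂ → ℂ}

theorem IsCubicChar.ne_zero (hχ : IsCubicChar π p χ) {ν : ℂ} (hν : ν ∈ O3) (h : ECoprime ν π) :
    χ ν ≠ 0 := fun h0 => by
  have := hχ.cube ν hν h
  rw [h0] at this
  norm_num at this

theorem IsCubicChar.sum_eq_mul_sum (hχ : IsCubicChar π p χ) (h : IsSplitPrime p π) {K k : ℂ → ℂ}
    (hK : ∀ a : ℕ, ¬ p ∣ a → K (a / π) = C * k (a / π)) :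
    ∑ a : Fin p, χ (a : ℕ) * K ((a : ℕ) / π) = C * ∑ a : Fin p, χ (a : ℕ) * k ((a : ℕ) / π) := by
  rw [Finset.mul_sum]
  refine Finset.sum_congr rfl fun a _ => ?_
  by_cases ha : p ∣ (a : ℕ)
  · rw [Nat.eq_zero_of_dvd_of_lt ha a.2, Nat.cast_zero,
      hχ.resChar.vanish 0 (zero_mem _) h.not_coprime_zero]
    ring
  · rw [hK a ha]; ring

theorem IsSplitPrime.finite_range_wpE_sqrtm3_pow_mul (h : IsSplitPrime p π) (a : ℕ) :
    (Set.range fun n : ℕ => wpE (sqrtm3 ^ n * (a / π))).Finite := by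
  have := h.finite_range_wpE fun n => mul_mem (pow_mem sqrtm3_mem_O3 n) (natCast_mem O3 a)
  simpa only [mul_div_assoc] using this

theorem IsSplitPrime.finite_range_wpE_sqrtm3_pow_succ_mul (h : IsSplitPrime p π) (a : ℕ) :
    (Set.range fun n : ℕ => wpE (sqrtm3 ^ n * (sqrtm3 * (a / π)))).Finite := by
  refine (h.finite_range_wpE_sqrtm3_pow_mul a).subset (Set.range_subset_iff.2 fun n => ⟨n + 1, ?_⟩)
  simp only [pow_succ, mul_assoc]

theorem IsChi0'₃.lvalue_ne_zero (hχ₀ : IsChi0'₃ χ₀) (h : IsSplitPrime p π)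
    (hprim : ECong π 1 3) (hp : p % 18 = 13) (hχ : IsCubicChar π p χ)
    (hL : IsLValue3 (fun ν => χ ν * χ₀ ν) L) : L ≠ 0 := by
  obtain ⟨K, ⟨C, hC, hK⟩, hsum⟩ := hχ₀.exists_lvalue_eq_sum h hprim
  obtain ⟨κ, hκ, hunit⟩ := exists_wpE_div_sub_one_lt_one
  obtain ⟨B, hB⟩ := exists_valuation_three_lt_one
  have hp3 : p % 3 = 1 := by omega
  have hp9 : p % 9 ≠ 1 := by omega
  have hnot := fun (a : ℕ) (ha : ¬ p ∣ a) => h.sqrtm3_pow_mul_div_notMem hp3 ha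
  have hnot1 : ∀ a : ℕ, ¬ p ∣ a → sqrtm3 * (a / π) ∉ O3 := fun a ha => by
    simpa using hnot a ha 1
  have hρ : χ ρ3 = ρ3 := by
    rw [h.cubicChar_ρ3 hp3 hχ, show (p - 1) / 3 = 3 * ((p - 1) / 9) + 1 by omega, pow_succ,
      pow_mul, ρ3_cube, one_pow, one_mul]
  have hS : ∑ a : Fin p, χ (a : ℕ) * (wpE ((a : ℕ) / π) / κ)⁻¹ ≠ 0 := by
    refine h.sum_mul_ne_zero (k := fun u => (wpE u / κ)⁻¹) hp3 hp9 hχ (fun z w hw => ?_)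
      (fun u => ?_) hB fun a ha => ?_
    · rw [wpE_periodic z w hw]
    · rw [hρ, wpE_ρ3, mul_div_assoc, mul_inv, mul_inv_cancel_left₀ ρ3_ne_zero]
    · exact B.valuation.inv_sub_one_lt_one
        (hunit B hB _ (hnot a ha) (h.finite_range_wpE_sqrtm3_pow_mul a))
  have hKS : ∑ a : Fin p, χ (a : ℕ) * K ((a : ℕ) / π) =
      C / κ * ∑ a : Fin p, χ (a : ℕ) * (wpE ((a : ℕ) / π) / κ)⁻¹ := by
    refine hχ.sum_eq_mul_sum h (k := fun u => (wpE u / κ)⁻¹) fun a ha => ?_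
    have h1 := hK _ (hnot1 a ha)
    have h2 := wpE_ne_zero (hnot1 a ha)
    field_simp
    exact h1
  have hχ3 : χ sqrtm3 ≠ 0 := hχ.ne_zero sqrtm3_mem_O3
    (.of_mul_eq_three hprim (neg_mem sqrtm3_mem_O3) sqrtm3_mul_neg_sqrtm3)
  have hG : heckeG 1 (sqrtm3 * π) ≠ 0 := heckeG_ne_zero (mul_ne_zero sqrtm3_ne_zero h.ne_zero) 1
  rw [hsum χ L hχ hL, hKS]
  exact mul_ne_zero (by norm_num) (mul_ne_zero (mul_ne_zero hχ3 hG)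
    (mul_ne_zero (div_ne_zero hC hκ) hS))

theorem IsChi0₃.lvalue_ne_zero (hχ₀ : IsChi0₃ χ₀) (h : IsSplitPrime p π)
    (hprim : ECong π 1 3) (hp : p % 18 = 7) (hχ : IsCubicChar π p χ)
    (hL : IsLValue3 (fun ν => χ ν * (starRingEnd ℂ) (χ₀ ν)) L) : L ≠ 0 := by
  obtain ⟨K, ⟨C, hC, hK⟩, hsum⟩ := hχ₀.exists_lvalue_eq_sum h hprim
  obtain ⟨κ, hκ, hunit⟩ := exists_wpE_div_sub_one_lt_one
  obtain ⟨B, hB⟩ := exists_valuation_three_lt_one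
  have hp3 : p % 3 = 1 := by omega
  have hp9 : p % 9 ≠ 1 := by omega
  have hnot := fun (a : ℕ) (ha : ¬ p ∣ a) => h.sqrtm3_pow_mul_div_notMem hp3 ha
  have hnot1 : ∀ a : ℕ, ¬ p ∣ a → ∀ n : ℕ, sqrtm3 ^ n * (sqrtm3 * (a / π)) ∉ O3 := fun a ha n => by
    rw [← mul_assoc, ← pow_succ]; exact hnot a ha (n + 1)
  have hρ : χ ρ3 = ρ3 ^ 2 := by
    rw [h.cubicChar_ρ3 hp3 hχ, show (p - 1) / 3 = 3 * ((p - 1) / 9) + 2 by omega, pow_add,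
      pow_mul, ρ3_cube, one_pow, one_mul]
  have hS : ∑ a : Fin p, χ (a : ℕ) *
      (wpE ((a : ℕ) / π) / κ * (wpE (sqrtm3 * ((a : ℕ) / π)) / κ))⁻¹ ≠ 0 := by
    refine h.sum_mul_ne_zero (k := fun u => (wpE u / κ * (wpE (sqrtm3 * u) / κ))⁻¹) hp3 hp9 hχ
      (fun z w hw => ?_) (fun u => ?_) hB fun a ha => ?_
    · rw [mul_add, wpE_periodic z w hw, wpE_periodic _ _ (mul_mem sqrtm3_mem_O3 hw)]
    · have hne := pow_ne_zero 2 ρ3_ne_zero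
      have h1 : ρ3 * wpE u / κ * (ρ3 * wpE (sqrtm3 * u) / κ) =
          ρ3 ^ 2 * (wpE u / κ * (wpE (sqrtm3 * u) / κ)) := by ring
      rw [hρ, mul_left_comm, wpE_ρ3, wpE_ρ3, h1, mul_inv, mul_inv_cancel_left₀ hne]
    · exact B.valuation.inv_sub_one_lt_one (B.valuation.mul_sub_one_lt_one
        (hunit B hB _ (hnot a ha) (h.finite_range_wpE_sqrtm3_pow_mul a))
        (hunit B hB _ (hnot1 a ha) (h.finite_range_wpE_sqrtm3_pow_succ_mul a)))
  have hKS : ∑ a : Fin p, χ (a : ℕ) * K ((a : ℕ) / π) = C / κ ^ 2 * ∑ a : Fin p, χ (a : ℕ) *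
      (wpE ((a : ℕ) / π) / κ * (wpE (sqrtm3 * ((a : ℕ) / π)) / κ))⁻¹ := by
    refine hχ.sum_eq_mul_sum h (k := fun u => (wpE u / κ * (wpE (sqrtm3 * u) / κ))⁻¹)
      fun a ha => ?_
    have h0 : sqrtm3 * (sqrtm3 * (a / π)) ∉ O3 := by simpa using hnot1 a ha 1
    have h1 := hK _ fun h3 => h0 (sqrtm3_mul_sqrtm3_mem.2 h3)
    have h2 := wpE_ne_zero (u := a / π) (by simpa using hnot1 a ha 0)
    have h3 := wpE_ne_zero h0
    generalize wpE (sqrtm3 * (a / π)) = y at *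
    field_simp
    exact h1
  have hχ3 : χ 3 ≠ 0 := hχ.ne_zero (ofNat_mem O3 3)
    (.of_mul_eq_three hprim (one_mem _) (mul_one _))
  have hG : heckeG 1 (3 * π) ≠ 0 := heckeG_ne_zero (mul_ne_zero three_ne_zero h.ne_zero) 1
  rw [hsum χ L hχ hL, hKS]
  exact mul_ne_zero (by norm_num) (mul_ne_zero (mul_ne_zero hχ3 hG)
    (mul_ne_zero (div_ne_zero hC (pow_ne_zero 2 hκ)) hS))

end

/-- **Corollary I.1.** Let `π ∈ ℤ[ρ]` be a primary prime with `p = π·π̄` and let `χ̃_π`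
be the associated Hecke character of weight one. If `p ≡ 7` or `13 (mod 18)`, then
`L(1, χ̃_π) ≠ 0`. -/
theorem stmt_5
    (p : ℕ) (hp : p.Prime) (hp3 : p % 3 = 1)
    (π : ℂ) (hπ : π ∈ O3) (hprimary : ECong π 1 3)
    (hnorm : (p : ℂ) = π * (starRingEnd ℂ) π)
    (χ : ℂ → ℂ) (hχ : IsCubicChar π p χ)
    (χ₀ : ℂ → ℂ) (hχ₀ : IsChi0₃ χ₀)
    (χ₀' : ℂ → ℂ) (hχ₀' : IsChi0'₃ χ₀') :
    (p % 18 = 7 → ∀ L : ℂ,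
      IsLValue3 (fun ν => χ ν * (starRingEnd ℂ) (χ₀ ν)) L → L ≠ 0) ∧
    (p % 18 = 13 → ∀ L : ℂ,
      IsLValue3 (fun ν => χ ν * χ₀' ν) L → L ≠ 0) := by
  have h : IsSplitPrime p π := ⟨hp, hπ, hnorm⟩
  exact ⟨fun hp7 _ hL => hχ₀.lvalue_ne_zero h hprimary hp7 hχ hL,
    fun hp13 _ hL => hχ₀'.lvalue_ne_zero h hprimary hp13 hχ hL⟩

end
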